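/- Equip ℝ^{n+1} with the metric d((x',t),(y',u)) = (|x'-y'|⁴ + (t-u)²)^{1/4}, where |·| is the Euclidean norm on ℝ^n. Let μ be a Radon measure on (ℝ^{n+1}, d) and s > 0 be such that lim_{r→0⁺} r^{-s} μ(B_d(x,r)) exists and is positive and finite on a set of positive μ-measure, where B_d(x,r) is the closed d-ball. Then s is an integer. -/

import Mathlib

open MeasureTheory Set Filter ENNReal NNReal

noncomputable section

/-- `ℝ^{n+1}`, viewed as `ℝⁿ × ℝ`. -/
abbrev Sp (n : ℕ) := EuclideanSpace ℝ (Fin n) × ℝ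

/-- The metric `d((x',t),(y',u)) = (|x'-y'|⁴ + (t-u)²)^{1/4}` on `ℝ^{n+1}`,
where `|·|` is the Euclidean norm on `ℝⁿ`. -/
def dK {n : ℕ} (x y : Sp n) : ℝ := (‖x.1 - y.1‖ ^ 4 + (x.2 - y.2) ^ 2) ^ ((1 : ℝ) / 4)

/-- The closed `d`-ball of center `x` and radius `r`. -/
def ballK {n : ℕ} (x : Sp n) (r : ℝ) : Set (Sp n) := {y | dK x y ≤ r}

/-- `lim_{r→0⁺} r^{-s} μ(B_d(x,r)) = d`. -/
def HasDensityK {n : ℕ} (μ : Measure (Sp n)) (s : ℝ) (x : Sp n) (d : ℝ≥0∞) : Prop :=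
  Tendsto (fun r : ℝ => μ (ballK x r) / ENNReal.ofReal (r ^ s)) (nhdsWithin 0 (Ioi 0)) (nhds d)

/-! ## Basic properties of the metric -/

lemma dK_nonneg {n : ℕ} (x y : Sp n) : 0 ≤ dK x y := by unfold dK; positivity

lemma dK_pow {n : ℕ} (x y : Sp n) : dK x y ^ 4 = ‖x.1 - y.1‖ ^ 4 + (x.2 - y.2) ^ 2 := by
  unfold dK
  rw [← Real.rpow_natCast, ← Real.rpow_mul (by positivity)]
  norm_num

lemma dK_le_iff {n : ℕ} (x y : Sp n) {r : ℝ} (hr : 0 ≤ r) :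
    dK x y ≤ r ↔ ‖x.1 - y.1‖ ^ 4 + (x.2 - y.2) ^ 2 ≤ r ^ 4 := by
  rw [← dK_pow]
  exact (pow_le_pow_iff_left₀ (dK_nonneg _ _) hr (by norm_num)).symm

lemma dK_self {n : ℕ} (x : Sp n) : dK x x = 0 := by
  have := dK_pow x x
  simp at this
  exact this

lemma dK_comm {n : ℕ} (x y : Sp n) : dK x y = dK y x := by
  unfold dK
  rw [norm_sub_rev, show (x.2 - y.2) ^ 2 = (y.2 - x.2) ^ 2 by ring]

lemma norm_le_dK {n : ℕ} (x y : Sp n) : ‖x.1 - y.1‖ ≤ dK x y := by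
  have h := dK_pow x y
  exact le_of_pow_le_pow_left₀ (n := 4) (by norm_num) (dK_nonneg _ _)
    (by rw [h]; nlinarith [sq_nonneg (x.2 - y.2)])

lemma abs_le_dK {n : ℕ} (x y : Sp n) : |x.2 - y.2| ≤ dK x y ^ 2 := by
  have h := dK_pow x y
  apply abs_le_of_sq_le_sq _ (by positivity)
  have : 0 ≤ ‖x.1 - y.1‖ ^ 4 := by positivity
  nlinarith

lemma dK_triangle {n : ℕ} (x y z : Sp n) : dK x z ≤ dK x y + dK y z := by
  have h1 := dK_pow x y
  have h2 := dK_pow y z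
  have n1 := norm_le_dK x y
  have n2 := norm_le_dK y z
  have p1 := dK_nonneg x y
  have p2 := dK_nonneg y z
  rw [dK_le_iff _ _ (by positivity)]
  have hn : ‖x.1 - z.1‖ ≤ ‖x.1 - y.1‖ + ‖y.1 - z.1‖ := by
    have := norm_add_le (x.1 - y.1) (y.1 - z.1)
    simpa using this
  have ht : x.2 - z.2 = (x.2 - y.2) + (y.2 - z.2) := by ring
  rw [ht]
  generalize dK x y = p at *
  generalize dK y z = q at *
  have hc0 : 0 ≤ ‖x.1 - z.1‖ := norm_nonneg _
  generalize ‖x.1 - z.1‖ = c at *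
  have ha : 0 ≤ ‖x.1 - y.1‖ := norm_nonneg _
  have hb : 0 ≤ ‖y.1 - z.1‖ := norm_nonneg _
  generalize ‖x.1 - y.1‖ = a at *
  generalize ‖y.1 - z.1‖ = b at *
  generalize x.2 - y.2 = t at *
  generalize y.2 - z.2 = u at *
  have hc : c ^ 4 ≤ (a + b) ^ 4 := pow_le_pow_left₀ hc0 hn 4
  -- Cauchy-Schwarz
  have cs : a ^ 2 * b ^ 2 + t * u ≤ p ^ 2 * q ^ 2 := by
    apply le_of_sq_le_sq _ (by positivity)
    have : (p ^ 2 * q ^ 2) ^ 2 = (a ^ 4 + t ^ 2) * (b ^ 4 + u ^ 2) := by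
      rw [← h1, ← h2]; ring
    rw [this]
    nlinarith [sq_nonneg (a ^ 2 * u - b ^ 2 * t)]
  have ab : a * b ≤ p * q := mul_le_mul n1 n2 hb p1
  have ab' : (a * b) ^ 2 ≤ (p * q) ^ 2 := pow_le_pow_left₀ (by positivity) ab 2
  have a2 : a ^ 2 ≤ p ^ 2 := pow_le_pow_left₀ ha n1 2
  have b2 : b ^ 2 ≤ q ^ 2 := pow_le_pow_left₀ hb n2 2
  have k1 : a * b * (a ^ 2 + b ^ 2) ≤ p * q * (p ^ 2 + q ^ 2) := by
    apply mul_le_mul ab (by linarith) (by positivity) (by positivity)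
  nlinarith

lemma continuous_dK {n : ℕ} : Continuous (fun p : Sp n × Sp n => dK p.1 p.2) := by
  unfold dK
  apply Continuous.rpow_const
  · fun_prop
  · intro x; right; norm_num

lemma continuous_dK_right {n : ℕ} (x : Sp n) : Continuous (fun y : Sp n => dK x y) := by
  unfold dK
  apply Continuous.rpow_const
  · fun_prop
  · intro x; right; norm_num

lemma isClosed_ballK {n : ℕ} (x : Sp n) (r : ℝ) : IsClosed (ballK x r) :=
  isClosed_le (continuous_dK_right x) continuous_const

lemma measurableSet_ballK {n : ℕ} (x : Sp n) (r : ℝ) : MeasurableSet (ballK x r) :=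
  (isClosed_ballK x r).measurableSet

lemma mem_ballK {n : ℕ} {x y : Sp n} {r : ℝ} : y ∈ ballK x r ↔ dK x y ≤ r := Iff.rfl

lemma mem_ballK_self {n : ℕ} {x : Sp n} {r : ℝ} (hr : 0 ≤ r) : x ∈ ballK x r := by
  rw [mem_ballK, dK_self]; exact hr

lemma isCompact_ballK {n : ℕ} (x : Sp n) (r : ℝ) : IsCompact (ballK x r) := by
  have : IsCompact (Metric.closedBall x.1 r ×ˢ Metric.closedBall x.2 (r ^ 2)) :=
    (isCompact_closedBall _ _).prod (isCompact_closedBall _ _)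
  apply this.of_isClosed_subset (isClosed_ballK x r)
  intro y hy
  have hy : dK x y ≤ r := hy
  refine ⟨?_, ?_⟩
  · rw [Metric.mem_closedBall', dist_eq_norm]
    exact (norm_le_dK x y).trans hy
  · rw [Metric.mem_closedBall', Real.dist_eq]
    exact (abs_le_dK x y).trans (pow_le_pow_left₀ (dK_nonneg _ _) hy 2)

lemma ballK_mono {n : ℕ} (x : Sp n) {r r' : ℝ} (h : r ≤ r') : ballK x r ⊆ ballK x r' :=
  fun _ hy => le_trans hy h

lemma ballK_subset {n : ℕ} {x y : Sp n} {r r' : ℝ} (h : dK x y + r ≤ r') :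
    ballK y r ⊆ ballK x r' := by
  intro z hz
  have hz : dK y z ≤ r := hz
  rw [mem_ballK]
  linarith [dK_triangle x y z]

lemma isOpen_oball {n : ℕ} (x : Sp n) (r : ℝ) : IsOpen {y | dK x y < r} :=
  isOpen_lt (continuous_dK_right x) continuous_const

lemma ballK_mem_nhds {n : ℕ} (x : Sp n) {r : ℝ} (hr : 0 < r) : ballK x r ∈ nhds x := by
  apply mem_of_superset ((isOpen_oball x r).mem_nhds (by simpa [dK_self] using hr))
  intro y hy
  have hy : dK x y < r := hy
  exact hy.le

lemma exists_ballK_subset {n : ℕ} {x : Sp n} {O : Set (Sp n)} (hO : O ∈ nhds x) :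
    ∃ ε > 0, ballK x ε ⊆ O := by
  obtain ⟨e, he, hsub⟩ := Metric.mem_nhds_iff.1 hO
  refine ⟨min (e / 2) 1, by positivity, ?_⟩
  intro y hy
  apply hsub
  have hy : dK x y ≤ min (e / 2) 1 := hy
  have h1 : dK x y ≤ e / 2 := hy.trans (min_le_left _ _)
  have h2 : dK x y ≤ 1 := hy.trans (min_le_right _ _)
  have h3 := norm_le_dK x y
  have h4 := abs_le_dK x y
  have h0 := dK_nonneg x y
  rw [Metric.mem_ball', Prod.dist_eq, max_lt_iff, dist_eq_norm, Real.dist_eq]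
  constructor
  · linarith
  · nlinarith

lemma dK_add_right {n : ℕ} (x y z : Sp n) : dK (x + z) (y + z) = dK x y := by
  simp [dK]

/-- The parabolic dilations. -/
def dil {n : ℕ} (r : ℝ) (x : Sp n) : Sp n := (r • x.1, r ^ 2 * x.2)

lemma dK_dil {n : ℕ} {r : ℝ} (hr : 0 ≤ r) (x y : Sp n) : dK (dil r x) (dil r y) = r * dK x y := by
  have h := dK_pow (dil r x) (dil r y)
  have h2 := dK_pow x y
  have : dK (dil r x) (dil r y) ^ 4 = (r * dK x y) ^ 4 := by
    rw [h, mul_pow, h2]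
    simp only [dil]
    rw [← smul_sub, norm_smul, Real.norm_of_nonneg hr]
    ring
  exact (pow_left_inj₀ (dK_nonneg _ _) (mul_nonneg hr (dK_nonneg _ _)) (by norm_num)).1 this

lemma dil_dil {n : ℕ} (r r' : ℝ) (x : Sp n) : dil r (dil r' x) = dil (r * r') x := by
  simp [dil, smul_smul]; ring

lemma dil_one {n : ℕ} (x : Sp n) : dil 1 x = x := by
  simp [dil]

lemma dil_zero {n : ℕ} (r : ℝ) : dil r (0 : Sp n) = 0 := by
  ext <;> simp [dil]

lemma continuous_dil {n : ℕ} (r : ℝ) : Continuous (dil r : Sp n → Sp n) := by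
  unfold dil; fun_prop

/-- Blow-up map at `x` with factor `r`: `y ↦ δ_r (y - x)`. -/
def blow {n : ℕ} (x : Sp n) (r : ℝ) (y : Sp n) : Sp n := dil r (y - x)

lemma dK_blow {n : ℕ} {r : ℝ} (hr : 0 ≤ r) (x y z : Sp n) :
    dK (blow x r y) (blow x r z) = r * dK y z := by
  unfold blow
  rw [dK_dil hr, sub_eq_add_neg, sub_eq_add_neg, dK_add_right]

lemma continuous_blow {n : ℕ} (x : Sp n) (r : ℝ) : Continuous (blow x r) :=
  (continuous_dil r).comp (by fun_prop)

lemma blow_self {n : ℕ} (x : Sp n) (r : ℝ) : blow x r x = 0 := by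
  simp [blow, dil_zero]

lemma blow_surj {n : ℕ} (x : Sp n) {r : ℝ} (hr : 0 < r) (y : Sp n) : ∃ z, blow x r z = y := by
  refine ⟨dil r⁻¹ y + x, ?_⟩
  simp [blow, dil_dil, mul_inv_cancel₀ hr.ne', dil_one]

lemma blow_preimage_ballK {n : ℕ} {r : ℝ} (hr : 0 < r) (x y : Sp n) (R : ℝ) :
    blow x r ⁻¹' (ballK (blow x r y) R) = ballK y (R / r) := by
  ext z
  simp only [mem_preimage, mem_ballK, dK_blow hr.le]
  rw [le_div_iff₀ hr, mul_comm]

/-- Rescaled measure. -/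
def bmeas {n : ℕ} (μ : Measure (Sp n)) (x : Sp n) (r : ℝ) (c : ℝ≥0∞) : Measure (Sp n) :=
  c • μ.map (blow x r)

lemma bmeas_ballK {n : ℕ} (μ : Measure (Sp n)) (x : Sp n) {r : ℝ} (hr : 0 < r) (c : ℝ≥0∞)
    (y : Sp n) (R : ℝ) : bmeas μ x r c (ballK (blow x r y) R) = c * μ (ballK y (R / r)) := by
  unfold bmeas
  rw [Measure.smul_apply, Measure.map_apply (continuous_blow x r).measurable
    (measurableSet_ballK _ _), blow_preimage_ballK hr, smul_eq_mul]

lemma bmeas_finite {n : ℕ} (μ : Measure (Sp n)) [IsFiniteMeasureOnCompacts μ] (x : Sp n) {r : ℝ}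
    (hr : 0 < r) {c : ℝ≥0∞} (hc : c ≠ ⊤) : IsFiniteMeasureOnCompacts (bmeas μ x r c) := by
  constructor
  intro K hK
  obtain ⟨R, hR⟩ : ∃ R, K ⊆ ballK (0 : Sp n) R := by
    obtain ⟨R, hR⟩ := (hK.image (continuous_dK_right (0 : Sp n))).bddAbove
    exact ⟨R, fun y hy => hR ⟨y, hy, rfl⟩⟩
  refine (measure_mono hR).trans_lt ?_
  rw [← blow_self x r, bmeas_ballK μ x hr]
  exact ENNReal.mul_lt_top hc.lt_top (isCompact_ballK _ _).measure_lt_top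

lemma blow_injective {n : ℕ} (x : Sp n) {r : ℝ} (hr : 0 < r) : Function.Injective (blow x r) := by
  intro y z h
  have h2 : dil r⁻¹ (blow x r y) = dil r⁻¹ (blow x r z) := by rw [h]
  simpa [blow, dil_dil, inv_mul_cancel₀ hr.ne', dil_one] using h2

lemma bmeas_apply {n : ℕ} (μ : Measure (Sp n)) (x : Sp n) {r : ℝ} (hr : 0 < r) (c : ℝ≥0∞)
    (A : Set (Sp n)) : bmeas μ x r c A = c * μ (blow x r ⁻¹' A) := by
  unfold bmeas
  rw [Measure.smul_apply, ((continuous_blow x r).measurableEmbedding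
    (blow_injective x hr)).map_apply, smul_eq_mul]


/-! ## Limits of measures along ultrafilters -/

/-- A cut-off function. -/
lemma exists_bump {n : ℕ} (x : Sp n) {a b : ℝ} (hab : a < b) :
    ∃ f : CompactlySupportedContinuousMap (Sp n) ℝ, (∀ y, 0 ≤ f y ∧ f y ≤ 1) ∧
      (∀ y ∈ ballK x a, f y = 1) ∧ tsupport f ⊆ ballK x b ∧ (∀ y, y ∉ ballK x b → f y = 0) := by
  let g : Sp n → ℝ := fun y => max 0 (min 1 ((b - dK x y) / (b - a)))
  have hg : Continuous g := by
    have := continuous_dK_right x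
    fun_prop
  have h0 : ∀ y, y ∉ ballK x b → g y = 0 := by
    intro y hy
    rw [mem_ballK, not_le] at hy
    apply max_eq_left
    apply (min_le_right _ _).trans
    apply div_nonpos_of_nonpos_of_nonneg <;> linarith
  have hts : tsupport g ⊆ ballK x b := by
    apply closure_minimal _ (isClosed_ballK x b)
    intro y hy
    by_contra h
    exact hy (h0 y h)
  refine ⟨⟨⟨g, hg⟩, (isCompact_ballK x b).of_isClosed_subset (isClosed_tsupport _) hts⟩,
    ?_, ?_, hts, h0⟩
  · intro y
    exact ⟨le_max_left _ _, max_le zero_le_one (min_le_left _ _)⟩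
  · intro y hy
    have hy : dK x y ≤ a := hy
    show max 0 (min 1 ((b - dK x y) / (b - a))) = 1
    rw [min_eq_left, max_eq_right zero_le_one]
    rw [le_div_iff₀ (by linarith)]
    linarith

/-- Ultralimit of sets. -/
def ulim {n : ℕ} (U : Ultrafilter ℕ) (A : ℕ → Set (Sp n)) : Set (Sp n) :=
  {x | ∀ ε > 0, ∀ᶠ k in (U : Filter ℕ), ∃ y ∈ A k, dK x y < ε}

lemma isClosed_ulim {n : ℕ} (U : Ultrafilter ℕ) (A : ℕ → Set (Sp n)) : IsClosed (ulim U A) := by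
  rw [← closure_subset_iff_isClosed]
  intro x hx ε hε
  rw [mem_closure_iff_nhds] at hx
  obtain ⟨z, hz, hzA⟩ := hx _ (ballK_mem_nhds x (half_pos hε))
  filter_upwards [hzA (ε / 2) (half_pos hε)] with k ⟨y, hy, hyz⟩
  refine ⟨y, hy, ?_⟩
  have hz : dK x z ≤ ε / 2 := hz
  linarith [dK_triangle x z y]

/-- `ν` is an `s`-uniform measure with support `S`, `0 ∈ S`. -/
structure Unif {n : ℕ} (s : ℝ) (S : Set (Sp n)) (ν : Measure (Sp n)) : Prop where
  closed : IsClosed S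
  null : ν Sᶜ = 0
  ball : ∀ x ∈ S, ∀ r > 0, ν (ballK x r) = ENNReal.ofReal (r ^ s)
  zero : (0 : Sp n) ∈ S

lemma exists_functional {n : ℕ} (U : Ultrafilter ℕ) (ν : ℕ → Measure (Sp n))
    [∀ k, IsFiniteMeasureOnCompacts (ν k)]
    (hb : ∀ R > 0, ∃ M : ℝ, ∀ᶠ k in (U : Filter ℕ), ν k (ballK 0 R) ≤ ENNReal.ofReal M) :
    ∃ Λ : CompactlySupportedContinuousMap (Sp n) ℝ →ₚ[ℝ] ℝ,
      ∀ f : CompactlySupportedContinuousMap (Sp n) ℝ,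
        Tendsto (fun k => ∫ x, f x ∂(ν k)) U (nhds (Λ f)) := by
  have hIntg : ∀ (f : CompactlySupportedContinuousMap (Sp n) ℝ) k, Integrable f (ν k) :=
    fun f k => f.continuous.integrable_of_hasCompactSupport f.hasCompactSupport
  have key : ∀ f : CompactlySupportedContinuousMap (Sp n) ℝ,
      ∃ l : ℝ, Tendsto (fun k => ∫ x, f x ∂(ν k)) U (nhds l) := by
    intro f
    obtain ⟨C, hC⟩ := f.continuous.bounded_above_of_compact_support f.hasCompactSupport
    obtain ⟨R, hR⟩ := (f.hasCompactSupport.isCompact.image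
      (continuous_dK_right (0 : Sp n))).bddAbove
    obtain ⟨M, hM⟩ := hb (max R 1) (by positivity)
    have hbd : ∀ᶠ k in (U : Filter ℕ), (∫ x, f x ∂(ν k)) ∈ Metric.closedBall (0 : ℝ)
        (C * (ENNReal.ofReal M).toReal) := by
      filter_upwards [hM] with k hk
      rw [mem_closedBall_zero_iff]
      have h1 : ∫ x, f x ∂(ν k) = ∫ x in ballK 0 (max R 1), f x ∂(ν k) := by
        rw [setIntegral_eq_integral_of_forall_compl_eq_zero]
        intro x hx
        by_contra h
        apply hx
        have : dK 0 x ≤ R := hR ⟨x, subset_tsupport _ h, rfl⟩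
        exact this.trans (le_max_left _ _)
      rw [h1]
      have h2 := norm_setIntegral_le_of_norm_le_const (μ := ν k) (s := ballK 0 (max R 1))
        (f := f) (C := C) (isCompact_ballK _ _).measure_lt_top (fun x _ => hC x)
      refine h2.trans ?_
      apply mul_le_mul_of_nonneg_left _ ((norm_nonneg _).trans (hC 0))
      exact ENNReal.toReal_mono ENNReal.ofReal_ne_top hk
    have hc := isCompact_closedBall (0 : ℝ) (C * (ENNReal.ofReal M).toReal)
    obtain ⟨l, _, hl⟩ := hc.ultrafilter_le_nhds (U.map fun k => ∫ x, f x ∂(ν k))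
      (by rw [le_principal_iff]; exact hbd)
    exact ⟨l, hl⟩
  choose Λ hΛ using key
  refine ⟨PositiveLinearMap.mk₀ ⟨⟨Λ, ?_⟩, ?_⟩ ?_, hΛ⟩
  · intro f g
    apply tendsto_nhds_unique (hΛ (f + g))
    have := (hΛ f).add (hΛ g)
    refine this.congr fun k => ?_
    rw [← integral_add (hIntg f k) (hIntg g k)]
    rfl
  · intro c f
    apply tendsto_nhds_unique (hΛ (c • f))
    have := (hΛ f).const_mul c
    refine this.congr fun k => ?_
    rw [← integral_const_mul]
    rfl
  · intro f hf
    exact ge_of_tendsto' (hΛ f) fun k => integral_nonneg hf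

lemma limit_lemma {n : ℕ} {s : ℝ} (hs : 0 < s) (U : Ultrafilter ℕ) (ν : ℕ → Measure (Sp n))
    [∀ k, IsFiniteMeasureOnCompacts (ν k)] (A : ℕ → Set (Sp n)) (h0 : ∀ k, 0 ∈ A k)
    (h1 : ∀ R > 0, ∀ ε > 0, ∀ᶠ k in (U : Filter ℕ), ∀ x ∈ A k, x ∈ ballK 0 R → ∀ r, 0 < r → r ≤ R →
      ENNReal.ofReal ((1 - ε) * r ^ s) ≤ ν k (ballK x r) ∧
      ν k (ballK x r) ≤ ENNReal.ofReal ((1 + ε) * r ^ s))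
    (h2 : ∀ R > 0, ∀ ε > 0, ∀ᶠ k in (U : Filter ℕ),
      ν k (ballK 0 R \ A k) ≤ ENNReal.ofReal ε) :
    ∃ ν', Unif s (ulim U A) ν' := by
  obtain ⟨Λ, hΛ⟩ := exists_functional U ν (by
    intro R hR
    refine ⟨(1 + 1) * R ^ s, ?_⟩
    filter_upwards [h1 R hR 1 one_pos] with k hk
    exact (hk 0 (h0 k) (mem_ballK_self hR.le) R hR le_rfl).2)
  -- comparison of functional and measure of balls
  have up : ∀ (f : CompactlySupportedContinuousMap (Sp n) ℝ) (z : Sp n) (b M : ℝ),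
      0 ≤ M → (∀ y, 0 ≤ f y ∧ f y ≤ 1) → (∀ y, y ∉ ballK z b → f y = 0) →
      (∀ᶠ k in (U : Filter ℕ), ν k (ballK z b) ≤ ENNReal.ofReal M) → Λ f ≤ M := by
    intro f z b M hM0 hf hz hM
    apply le_of_tendsto (hΛ f)
    filter_upwards [hM] with k hk
    have e1 : ∫ x, f x ∂(ν k) = ∫ x in ballK z b, f x ∂(ν k) := by
      rw [setIntegral_eq_integral_of_forall_compl_eq_zero hz]
    rw [e1]
    have e2 := norm_setIntegral_le_of_norm_le_const (μ := ν k) (s := ballK z b)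
      (f := f) (C := 1) (isCompact_ballK _ _).measure_lt_top
      (fun x _ => by rw [Real.norm_of_nonneg (hf x).1]; exact (hf x).2)
    refine (le_abs_self _).trans (e2.trans ?_)
    rw [one_mul]
    exact ENNReal.toReal_le_of_le_ofReal hM0 hk
  have low : ∀ (f : CompactlySupportedContinuousMap (Sp n) ℝ) (z : Sp n) (b M : ℝ),
      (∀ y, 0 ≤ f y ∧ f y ≤ 1) → (∀ y ∈ ballK z b, f y = 1) →
      (∀ᶠ k in (U : Filter ℕ), ENNReal.ofReal M ≤ ν k (ballK z b)) → M ≤ Λ f := by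
    intro f z b M hf hz hM
    apply ge_of_tendsto (hΛ f)
    filter_upwards [hM] with k hk
    have hIntg : Integrable f (ν k) :=
      f.continuous.integrable_of_hasCompactSupport f.hasCompactSupport
    have e1 : ∫ x in ballK z b, f x ∂(ν k) ≤ ∫ x, f x ∂(ν k) :=
      setIntegral_le_integral hIntg (Eventually.of_forall fun x => (hf x).1)
    refine le_trans ?_ e1
    rw [setIntegral_congr_fun (measurableSet_ballK z b) (g := fun _ => (1 : ℝ))
      (fun x hx => hz x hx)]
    rw [setIntegral_const, smul_eq_mul, mul_one]
    exact (ENNReal.ofReal_le_iff_le_toReal (isCompact_ballK _ _).measure_lt_top.ne).1 hk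
  have zmem : (0 : Sp n) ∈ ulim U A := by
    intro ε hε
    exact Eventually.of_forall fun k => ⟨0, h0 k, by rw [dK_self]; exact hε⟩
  refine ⟨RealRMK.rieszMeasure Λ, isClosed_ulim U A, ?_, ?_, zmem⟩
  · -- null
    apply measure_null_of_locally_null
    intro x hx
    simp only [ulim, mem_compl_iff, mem_ofPred_eq, not_forall] at hx
    obtain ⟨ε, hε, hx⟩ := hx
    rw [← Ultrafilter.eventually_not] at hx
    refine ⟨ballK x (ε / 3), mem_nhdsWithin_of_mem_nhds (ballK_mem_nhds x (by positivity)), ?_⟩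
    obtain ⟨f, hf, hf1, -, hf2⟩ := exists_bump x (show ε / 3 < ε / 2 by linarith)
    have := RealRMK.rieszMeasure_le_of_eq_one Λ (fun y => (hf y).1) (isCompact_ballK x (ε / 3)) hf1
    apply le_antisymm _ (zero_le)
    refine this.trans ?_
    rw [nonpos_iff_eq_zero, ENNReal.ofReal_eq_zero]
    apply _root_.le_of_forall_pos_le_add
    intro η hη
    rw [zero_add]
    apply up f x (ε / 2) η hη.le hf hf2
    have hR : 0 < dK 0 x + ε / 2 := by linarith [dK_nonneg 0 x]
    filter_upwards [hx, h2 _ hR η hη] with k hk1 hk2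
    refine le_trans (measure_mono ?_) hk2
    intro y hy
    refine ⟨ballK_subset le_rfl hy, fun hyA => hk1 ⟨y, hyA, ?_⟩⟩
    have hy : dK x y ≤ ε / 2 := hy
    linarith
  · intro x hx r hr
    have hcont : ContinuousAt (fun e : ℝ => (1 + e) * (r + 2 * e) ^ s) 0 := by
      apply ContinuousAt.mul (by fun_prop)
      apply ContinuousAt.rpow_const (by fun_prop)
      right; exact hs.le
    have hcont' : ContinuousAt (fun e : ℝ => (1 - e) * (r - 2 * e) ^ s) 0 := by
      apply ContinuousAt.mul (by fun_prop)
      apply ContinuousAt.rpow_const (by fun_prop)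
      right; exact hs.le
    have hpos : ∀ᶠ e : ℝ in nhdsWithin 0 (Ioi 0), 0 < e ∧ e < r / 4 ∧ e < 1 := by
      have : Ioo 0 (min (r / 4) 1) ∈ nhdsWithin (0 : ℝ) (Ioi 0) :=
        Ioo_mem_nhdsGT (by positivity)
      filter_upwards [this] with e he
      exact ⟨he.1, he.2.trans_le (min_le_left _ _), he.2.trans_le (min_le_right _ _)⟩
    apply le_antisymm
    · have ht : Tendsto (fun e : ℝ => ENNReal.ofReal ((1 + e) * (r + 2 * e) ^ s))
          (nhdsWithin 0 (Ioi 0)) (nhds (ENNReal.ofReal (r ^ s))) := by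
        apply ENNReal.tendsto_ofReal
        have := hcont.tendsto.mono_left (nhdsWithin_le_nhds (s := Ioi 0))
        simpa using this
      apply ge_of_tendsto ht
      filter_upwards [hpos] with e ⟨he, he2, he3⟩
      obtain ⟨f, hf, hf1, -, hf2⟩ := exists_bump x (show r < r + e by linarith)
      refine (RealRMK.rieszMeasure_le_of_eq_one Λ (fun y => (hf y).1)
        (isCompact_ballK x r) hf1).trans ?_
      apply ENNReal.ofReal_le_ofReal
      apply up f x (r + e) _ (by positivity) hf hf2
      have hR : 0 < dK 0 x + r + 2 * e := by linarith [dK_nonneg 0 x]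
      filter_upwards [hx e he, h1 _ hR e he] with k ⟨y, hyA, hy⟩ hk
      refine le_trans (measure_mono (ballK_subset (x := y) (r' := r + 2 * e) ?_))
        (hk y hyA ?_ (r + 2 * e) (by positivity) (by linarith [dK_nonneg 0 x])).2
      · rw [dK_comm]; linarith
      · rw [mem_ballK]
        linarith [dK_triangle 0 x y]
    · have ht : Tendsto (fun e : ℝ => ENNReal.ofReal ((1 - e) * (r - 2 * e) ^ s))
          (nhdsWithin 0 (Ioi 0)) (nhds (ENNReal.ofReal (r ^ s))) := by
        apply ENNReal.tendsto_ofReal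
        have := hcont'.tendsto.mono_left (nhdsWithin_le_nhds (s := Ioi 0))
        simpa using this
      apply le_of_tendsto ht
      filter_upwards [hpos] with e ⟨he, he2, he3⟩
      obtain ⟨f, hf, hf1, hf2, -⟩ := exists_bump x (show r - e < r by linarith)
      refine le_trans ?_ (RealRMK.le_rieszMeasure_tsupport_subset Λ hf hf2)
      apply ENNReal.ofReal_le_ofReal
      apply low f x (r - e) _ hf hf1
      have hR : 0 < dK 0 x + r + 2 * e := by linarith [dK_nonneg 0 x]
      filter_upwards [hx e he, h1 _ hR e he] with k ⟨y, hyA, hy⟩ hk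
      refine le_trans (hk y hyA ?_ (r - 2 * e) (by linarith) (by linarith [dK_nonneg 0 x])).1
        (measure_mono (ballK_subset ?_))
      · rw [mem_ballK]
        linarith [dK_triangle 0 x y]
      · linarith


/-! ## From densities to uniform measures -/

/-- Points where the ratios are pinched between `q₁` and `q₂` at scales below `δ`. -/
def Pinch {n : ℕ} (μ : Measure (Sp n)) (s q₁ q₂ δ : ℝ) : Set (Sp n) :=
  {x | ∀ r, 0 < r → r < δ → ENNReal.ofReal (q₁ * r ^ s) ≤ μ (ballK x r) ∧
    μ (ballK x r) ≤ ENNReal.ofReal (q₂ * r ^ s)}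

lemma isClosed_Pinch {n : ℕ} (μ : Measure (Sp n)) {s : ℝ} (hs : 0 < s) (q₁ q₂ δ : ℝ) :
    IsClosed (Pinch μ s q₁ q₂ δ) := by
  rw [← closure_subset_iff_isClosed]
  intro x hx r hr hrd
  rw [mem_closure_iff_nhds] at hx
  have hc : ∀ q σ : ℝ, Tendsto (fun e : ℝ => ENNReal.ofReal (q * (r + σ * e) ^ s))
      (nhdsWithin 0 (Ioi 0)) (nhds (ENNReal.ofReal (q * r ^ s))) := by
    intro q σ
    apply ENNReal.tendsto_ofReal
    have : ContinuousAt (fun e : ℝ => q * (r + σ * e) ^ s) 0 := by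
      apply ContinuousAt.mul (by fun_prop)
      apply ContinuousAt.rpow_const (by fun_prop)
      right; exact hs.le
    have := this.tendsto.mono_left (nhdsWithin_le_nhds (s := Ioi 0))
    simpa using this
  have hpos : ∀ᶠ e : ℝ in nhdsWithin 0 (Ioi 0), 0 < e ∧ e < r ∧ r + e < δ := by
    have : Ioo 0 (min r (δ - r)) ∈ nhdsWithin (0 : ℝ) (Ioi 0) :=
      Ioo_mem_nhdsGT (lt_min hr (by linarith))
    filter_upwards [this] with e he
    exact ⟨he.1, he.2.trans_le (min_le_left _ _),
      by linarith [he.2.trans_le (min_le_right r (δ - r))]⟩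
  constructor
  · apply le_of_tendsto (hc q₁ (-1))
    filter_upwards [hpos] with e ⟨he, he2, he3⟩
    obtain ⟨z, hz, hzA⟩ := hx _ (ballK_mem_nhds x he)
    have hz : dK x z ≤ e := hz
    refine (hzA (r + -1 * e) (by linarith) (by linarith)).1.trans (measure_mono (ballK_subset ?_))
    linarith
  · apply ge_of_tendsto (hc q₂ 1)
    filter_upwards [hpos] with e ⟨he, he2, he3⟩
    obtain ⟨z, hz, hzA⟩ := hx _ (ballK_mem_nhds x he)
    have hz : dK x z ≤ e := hz
    refine le_trans (measure_mono (ballK_subset ?_)) (hzA (r + 1 * e) (by linarith) (by linarith)).2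
    rw [dK_comm]
    linarith

/-- Almost every point of `Pinch` is a density point. -/
lemma density_point_aux {n : ℕ} (μ : Measure (Sp n)) [IsFiniteMeasureOnCompacts μ] {s : ℝ}
    (hs : 0 < s) {q₁ q₂ δ c : ℝ} (hδ : 0 < δ) (hc : 0 < c) :
    μ {x | x ∈ Pinch μ s q₁ q₂ δ ∧ ∃ᶠ r in nhdsWithin (0 : ℝ) (Ioi 0),
      ENNReal.ofReal (c * r ^ s) < μ (ballK x r \ Pinch μ s q₁ q₂ δ)} = 0 := by
  set F := Pinch μ s q₁ q₂ δ with hF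
  set N := {x | x ∈ F ∧ ∃ᶠ r in nhdsWithin (0 : ℝ) (Ioi 0),
      ENNReal.ofReal (c * r ^ s) < μ (ballK x r \ F)} with hN
  have hFm : MeasurableSet F := (isClosed_Pinch μ hs _ _ _).measurableSet
  have hlN : μ.restrict Fᶜ N = 0 := by
    rw [Measure.restrict_apply' hFm.compl]
    convert measure_empty (μ := μ)
    ext x
    simp only [mem_inter_iff, mem_compl_iff, mem_empty_iff_false, iff_false, not_and, not_not]
    exact fun hx => hx.1
  set K : ℝ := |q₂| * 3 ^ s / c with hK
  have hK0 : 0 ≤ K := by positivity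
  have main : ∀ ε : ℝ≥0∞, 0 < ε → μ N ≤ ENNReal.ofReal K * ε := by
    intro ε hε
    obtain ⟨O, hNO, hO, hOε⟩ := Set.exists_isOpen_lt_of_lt (μ := μ.restrict Fᶜ) N ε
      (by rw [hlN]; exact hε)
    let t : Set (Sp n × ℝ) := {p | p.1 ∈ N ∧ 0 < p.2 ∧ p.2 < δ / 3 ∧ ballK p.1 p.2 ⊆ O ∧
      ENNReal.ofReal (c * p.2 ^ s) < μ (ballK p.1 p.2 \ F)}
    obtain ⟨u, hut, hud, hu⟩ := Vitali.exists_disjoint_subfamily_covering_enlargement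
      (fun p : Sp n × ℝ => ballK p.1 p.2) t (fun p => p.2) 2 (by norm_num)
      (fun p hp => hp.2.1.le) (δ / 3) (fun p hp => hp.2.2.1.le)
      (fun p hp => ⟨p.1, mem_ballK_self hp.2.1.le⟩)
    have hucount : u.Countable := by
      apply hud.countable_of_nonempty_interior
      intro p hp
      exact ⟨p.1, mem_interior_iff_mem_nhds.2 (ballK_mem_nhds _ (hut hp).2.1)⟩
    have hcover : N ⊆ ⋃ p ∈ u, ballK p.1 (3 * p.2) := by
      intro x hx
      obtain ⟨e, he, heO⟩ := exists_ballK_subset (hO.mem_nhds (hNO hx))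
      have hev : ∀ᶠ r in nhdsWithin (0 : ℝ) (Ioi 0), 0 < r ∧ r < min e (δ / 3) :=
        Ioo_mem_nhdsGT (by positivity)
      obtain ⟨r, hr1, hr2, hr3⟩ := (hx.2.and_eventually hev).exists
      have hxt : (x, r) ∈ t := ⟨hx, hr2, hr3.trans_le (min_le_right _ _),
        (ballK_mono x (hr3.le.trans (min_le_left _ _))).trans heO, hr1⟩
      obtain ⟨b, hb, ⟨z, hz1, hz2⟩, hle⟩ := hu _ hxt
      refine mem_biUnion hb ?_
      have hz1 : dK x z ≤ r := hz1
      have hz2 : dK b.1 z ≤ b.2 := hz2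
      have hle : r ≤ 2 * b.2 := hle
      rw [mem_ballK]
      linarith [dK_triangle b.1 z x, dK_comm x z]
    calc μ N ≤ μ (⋃ p ∈ u, ballK p.1 (3 * p.2)) := measure_mono hcover
      _ ≤ ∑' p : u, μ (ballK p.1.1 (3 * p.1.2)) := measure_biUnion_le μ hucount _
      _ ≤ ∑' p : u, ENNReal.ofReal K * μ.restrict Fᶜ (ballK p.1.1 p.1.2) := by
        apply ENNReal.tsum_le_tsum
        rintro ⟨p, hp⟩
        obtain ⟨hpN, hp0, hpδ, hpO, hpc⟩ := hut hp
        refine (hpN.1 (3 * p.2) (by linarith) (by linarith)).2.trans ?_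
        rw [Measure.restrict_apply' hFm.compl]
        refine le_trans ?_ (mul_le_mul_right hpc.le _)
        rw [← ENNReal.ofReal_mul hK0]
        apply ENNReal.ofReal_le_ofReal
        rw [Real.mul_rpow (by norm_num) hp0.le, hK]
        have : |q₂| * 3 ^ s / c * (c * p.2 ^ s) = |q₂| * (3 ^ s * p.2 ^ s) := by
          field_simp
        rw [this]
        exact mul_le_mul_of_nonneg_right (le_abs_self _) (by positivity)
      _ = ENNReal.ofReal K * ∑' p : u, μ.restrict Fᶜ (ballK p.1.1 p.1.2) := ENNReal.tsum_mul_left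
      _ = ENNReal.ofReal K * μ.restrict Fᶜ (⋃ p ∈ u, ballK p.1 p.2) := by
        rw [measure_biUnion hucount hud (fun p _ => measurableSet_ballK _ _)]
      _ ≤ ENNReal.ofReal K * ε := by
        apply mul_le_mul_right
        refine le_trans (measure_mono ?_) hOε.le
        exact iUnion₂_subset fun p hp => (hut hp).2.2.2.1
  by_contra hne
  have hpos : 0 < μ N := pos_iff_ne_zero.2 hne
  have ht : Tendsto (fun ε : ℝ≥0∞ => ENNReal.ofReal K * ε) (nhdsWithin 0 (Ioi 0)) (nhds 0) := by
    have : Tendsto (fun ε : ℝ≥0∞ => ENNReal.ofReal K * ε) (nhds 0)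
        (nhds (ENNReal.ofReal K * 0)) :=
      ENNReal.Tendsto.const_mul tendsto_id (Or.inr ENNReal.ofReal_ne_top)
    rw [mul_zero] at this
    exact this.mono_left nhdsWithin_le_nhds
  have := ge_of_tendsto ht (by filter_upwards [self_mem_nhdsWithin] with ε hε using main ε hε)
  exact absurd this (not_le.2 hpos)


lemma exists_good_point {n : ℕ} (μ : Measure (Sp n)) [IsFiniteMeasureOnCompacts μ] {s : ℝ}
    (hs : 0 < s)
    (h : 0 < μ {x : Sp n | ∃ d : ℝ≥0∞, 0 < d ∧ d < ⊤ ∧ HasDensityK μ s x d}) :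
    ∃ x : Sp n, (∃ d : ℝ≥0∞, 0 < d ∧ d < ⊤ ∧ HasDensityK μ s x d) ∧
      ∀ (q₁ q₂ : ℚ) (m i : ℕ), x ∈ Pinch μ s q₁ q₂ (1 / ((m : ℝ) + 1)) →
        ∀ᶠ r in nhdsWithin (0 : ℝ) (Ioi 0),
          μ (ballK x r \ Pinch μ s q₁ q₂ (1 / ((m : ℝ) + 1))) ≤
            ENNReal.ofReal (1 / ((i : ℝ) + 1) * r ^ s) := by
  by_contra hcon
  push Not at hcon
  have hsub : {x : Sp n | ∃ d : ℝ≥0∞, 0 < d ∧ d < ⊤ ∧ HasDensityK μ s x d} ⊆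
      ⋃ (p : ℚ × ℚ × ℕ × ℕ), {x | x ∈ Pinch μ s p.1 p.2.1 (1 / ((p.2.2.1 : ℝ) + 1)) ∧
        ∃ᶠ r in nhdsWithin (0 : ℝ) (Ioi 0), ENNReal.ofReal (1 / ((p.2.2.2 : ℝ) + 1) * r ^ s) <
          μ (ballK x r \ Pinch μ s p.1 p.2.1 (1 / ((p.2.2.1 : ℝ) + 1)))} := by
    intro x hx
    obtain ⟨q₁, q₂, m, i, h1, h2⟩ := hcon x hx
    exact mem_iUnion.2 ⟨(q₁, q₂, m, i), h1, by simpa using h2⟩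
  have := measure_mono_null hsub (measure_iUnion_null fun p =>
    density_point_aux μ hs (by positivity) (by positivity))
  exact h.ne' this

lemma exists_scale {n : ℕ} (μ : Measure (Sp n)) {s : ℝ} {x : Sp n} {D : ℝ}
    (hD : 0 < D) (hd : HasDensityK μ s x (ENNReal.ofReal D))
    (hx : ∀ (q₁ q₂ : ℚ) (m i : ℕ), x ∈ Pinch μ s q₁ q₂ (1 / ((m : ℝ) + 1)) →
        ∀ᶠ r in nhdsWithin (0 : ℝ) (Ioi 0),
          μ (ballK x r \ Pinch μ s q₁ q₂ (1 / ((m : ℝ) + 1))) ≤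
            ENNReal.ofReal (1 / ((i : ℝ) + 1) * r ^ s)) (j : ℕ) :
    ∃ (F : Set (Sp n)) (ρ : ℝ), 0 < ρ ∧ x ∈ F ∧
      (∀ y ∈ F, ∀ r, 0 < r → r ≤ (j : ℝ) + 1 →
        ENNReal.ofReal ((1 - 1 / ((j : ℝ) + 1)) * (D * (r * ρ) ^ s)) ≤ μ (ballK y (r * ρ)) ∧
        μ (ballK y (r * ρ)) ≤ ENNReal.ofReal ((1 + 1 / ((j : ℝ) + 1)) * (D * (r * ρ) ^ s))) ∧
      μ (ballK x (((j : ℝ) + 1) * ρ) \ F) ≤ ENNReal.ofReal (1 / ((j : ℝ) + 1) * (D * ρ ^ s)) := by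
  have hj : (0 : ℝ) < (j : ℝ) + 1 := by positivity
  obtain ⟨q₁, hq1, hq1'⟩ := exists_rat_btwn (show (1 - 1 / ((j : ℝ) + 1)) * D < D by
    have : 0 < 1 / ((j : ℝ) + 1) * D := by positivity
    linarith)
  obtain ⟨q₂, hq2, hq2'⟩ := exists_rat_btwn (show D < (1 + 1 / ((j : ℝ) + 1)) * D by
    have : 0 < 1 / ((j : ℝ) + 1) * D := by positivity
    linarith)
  have hev : ∀ᶠ r in nhdsWithin (0 : ℝ) (Ioi 0),
      ENNReal.ofReal (q₁ * r ^ s) ≤ μ (ballK x r) ∧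
        μ (ballK x r) ≤ ENNReal.ofReal (q₂ * r ^ s) := by
    have h1 : ∀ᶠ r in nhdsWithin (0 : ℝ) (Ioi 0),
        ENNReal.ofReal q₁ < μ (ballK x r) / ENNReal.ofReal (r ^ s) :=
      hd.eventually_const_lt ((ENNReal.ofReal_lt_ofReal_iff hD).2 hq1')
    have h2 : ∀ᶠ r in nhdsWithin (0 : ℝ) (Ioi 0),
        μ (ballK x r) / ENNReal.ofReal (r ^ s) < ENNReal.ofReal q₂ :=
      hd.eventually_lt_const ((ENNReal.ofReal_lt_ofReal_iff (hD.trans hq2)).2 hq2)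
    filter_upwards [h1, h2, self_mem_nhdsWithin] with r h1 h2 hr
    have hr : 0 < r := hr
    have hrs : 0 < r ^ s := Real.rpow_pos_of_pos hr s
    have e0 : ENNReal.ofReal (r ^ s) ≠ 0 := by simpa using hrs
    rw [ENNReal.ofReal_mul' hrs.le, ENNReal.ofReal_mul' hrs.le]
    constructor
    · exact ENNReal.mul_le_of_le_div h1.le
    · exact (ENNReal.div_le_iff e0 ENNReal.ofReal_ne_top).1 h2.le
  obtain ⟨δ, hδ, hδ'⟩ := mem_nhdsGT_iff_exists_Ioo_subset.1 hev
  have hδ : 0 < δ := hδ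
  obtain ⟨m, hm⟩ := exists_nat_one_div_lt hδ
  have hxF : x ∈ Pinch μ s q₁ q₂ (1 / ((m : ℝ) + 1)) := by
    intro r hr hrm
    exact hδ' ⟨hr, hrm.trans hm⟩
  have hc : 0 < 1 / ((j : ℝ) + 1) * D / ((j : ℝ) + 1) ^ s := by positivity
  obtain ⟨i, hi⟩ := exists_nat_one_div_lt hc
  have hδm : 0 < 1 / ((m : ℝ) + 1) := by positivity
  obtain ⟨r, hr1, hr2, hr3⟩ := ((hx q₁ q₂ m i hxF).and
    (show ∀ᶠ r in nhdsWithin (0 : ℝ) (Ioi 0), 0 < r ∧ r < 1 / ((m : ℝ) + 1) from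
      Ioo_mem_nhdsGT hδm)).exists
  refine ⟨Pinch μ s q₁ q₂ (1 / ((m : ℝ) + 1)), r / ((j : ℝ) + 1), by positivity, hxF, ?_, ?_⟩
  · intro y hy t ht htj
    have h1 : 0 < t * (r / ((j : ℝ) + 1)) := by positivity
    have h2 : t * (r / ((j : ℝ) + 1)) ≤ r := by
      rw [← mul_div_assoc, div_le_iff₀ hj]
      nlinarith
    obtain ⟨k1, k2⟩ := hy _ h1 (h2.trans_lt hr3)
    have hp : 0 ≤ (t * (r / ((j : ℝ) + 1))) ^ s := by positivity
    constructor
    · refine le_trans (ENNReal.ofReal_le_ofReal ?_) k1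
      rw [← mul_assoc]
      exact mul_le_mul_of_nonneg_right hq1.le hp
    · refine le_trans k2 (ENNReal.ofReal_le_ofReal ?_)
      rw [← mul_assoc]
      exact mul_le_mul_of_nonneg_right hq2'.le hp
  · rw [mul_div_cancel₀ _ hj.ne']
    refine hr1.trans (ENNReal.ofReal_le_ofReal ?_)
    rw [Real.div_rpow hr2.le hj.le]
    have hp : 0 ≤ r ^ s := by positivity
    calc 1 / ((i : ℝ) + 1) * r ^ s ≤ 1 / ((j : ℝ) + 1) * D / ((j : ℝ) + 1) ^ s * r ^ s :=
        mul_le_mul_of_nonneg_right hi.le hp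
      _ = _ := by ring

lemma exists_unif {n : ℕ} (μ : Measure (Sp n)) [IsFiniteMeasureOnCompacts μ] {s : ℝ}
    (hs : 0 < s)
    (h : 0 < μ {x : Sp n | ∃ d : ℝ≥0∞, 0 < d ∧ d < ⊤ ∧ HasDensityK μ s x d}) :
    ∃ (S : Set (Sp n)) (ν : Measure (Sp n)), Unif s S ν := by
  obtain ⟨x, ⟨d, hd0, hdt, hd⟩, hx⟩ := exists_good_point μ hs h
  obtain ⟨D, hD, rfl⟩ : ∃ D : ℝ, 0 < D ∧ d = ENNReal.ofReal D :=
    ⟨d.toReal, ENNReal.toReal_pos hd0.ne' hdt.ne, (ENNReal.ofReal_toReal hdt.ne).symm⟩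
  choose F ρ hρ hxF hF1 hF2 using exists_scale μ hD hd hx
  let U : Ultrafilter ℕ := hyperfilter ℕ
  have hU : (U : Filter ℕ) ≤ atTop := Nat.hyperfilter_le_atTop
  let c : ℕ → ℝ := fun j => 1 / (D * ρ j ^ s)
  have hρs : ∀ j, 0 < ρ j ^ s := fun j => Real.rpow_pos_of_pos (hρ j) s
  have hc : ∀ j, 0 ≤ c j := fun j => by have := hρs j; positivity
  let ν : ℕ → Measure (Sp n) := fun j => bmeas μ x (1 / ρ j) (ENNReal.ofReal (c j))
  have hri : ∀ j, 0 < 1 / ρ j := fun j => one_div_pos.2 (hρ j)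
  have : ∀ j, IsFiniteMeasureOnCompacts (ν j) := fun j =>
    bmeas_finite μ x (hri j) ENNReal.ofReal_ne_top
  have hlarge : ∀ R : ℝ, ∀ ε > 0, ∀ᶠ j : ℕ in (U : Filter ℕ), R ≤ (j : ℝ) + 1 ∧
      1 / ((j : ℝ) + 1) ≤ ε := by
    intro R ε hε
    apply hU
    have h1 : ∀ᶠ j : ℕ in atTop, R ≤ (j : ℝ) :=
      tendsto_natCast_atTop_atTop.eventually_ge_atTop R
    have h2 : ∀ᶠ j : ℕ in atTop, 1 / ((j : ℝ) + 1) < ε :=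
      tendsto_one_div_add_atTop_nhds_zero_nat.eventually_lt_const hε
    filter_upwards [h1, h2] with j h1 h2
    exact ⟨by linarith, h2.le⟩
  refine ⟨_, limit_lemma hs U ν (fun j => blow x (1 / ρ j) '' F j)
    (fun j => ⟨x, hxF j, blow_self _ _⟩) ?_ ?_⟩
  · intro R hR ε hε
    filter_upwards [hlarge R ε hε] with j ⟨hj1, hj2⟩
    rintro _ ⟨y, hy, rfl⟩ - r hr hrR
    have e1 : ν j (ballK (blow x (1 / ρ j) y) r) =
        ENNReal.ofReal (c j) * μ (ballK y (r * ρ j)) := by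
      show bmeas _ _ _ _ _ = _
      rw [bmeas_ballK μ x (hri j), div_div_eq_mul_div, div_one]
    rw [e1]
    obtain ⟨k1, k2⟩ := hF1 j y hy r hr (hrR.trans hj1)
    have hrs : 0 ≤ r ^ s := by positivity
    have e2 : ∀ a : ℝ, a * r ^ s = c j * (a * (D * (r * ρ j) ^ s)) := by
      intro a
      rw [Real.mul_rpow hr.le (hρ j).le]
      have := (hρs j).ne'
      simp only [c]
      field_simp
    constructor
    · refine le_trans ?_ (mul_le_mul_right k1 _)
      rw [← ENNReal.ofReal_mul (hc j), ← e2]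
      apply ENNReal.ofReal_le_ofReal
      exact mul_le_mul_of_nonneg_right (by linarith) hrs
    · refine le_trans (mul_le_mul_right k2 _) ?_
      rw [← ENNReal.ofReal_mul (hc j), ← e2]
      apply ENNReal.ofReal_le_ofReal
      exact mul_le_mul_of_nonneg_right (by linarith) hrs
  · intro R hR ε hε
    filter_upwards [hlarge R ε hε] with j ⟨hj1, hj2⟩
    have e1 : ν j (ballK 0 R \ blow x (1 / ρ j) '' F j) ≤
        ENNReal.ofReal (c j) * μ (ballK x (((j : ℝ) + 1) * ρ j) \ F j) := by
      show bmeas _ _ _ _ _ ≤ _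
      rw [bmeas_apply μ x (hri j)]
      apply mul_le_mul_right
      apply measure_mono
      rintro w ⟨hz1, hz2⟩
      refine ⟨?_, fun hw => hz2 ⟨w, hw, rfl⟩⟩
      rw [← blow_self x (1 / ρ j), mem_ballK, dK_blow (hri j).le] at hz1
      rw [mem_ballK]
      have : dK x w ≤ R * ρ j := by
        rw [one_div, inv_mul_le_iff₀ (hρ j)] at hz1
        linarith
      exact this.trans (mul_le_mul_of_nonneg_right hj1 (hρ j).le)
    refine e1.trans ((mul_le_mul_right (hF2 j) _).trans ?_)
    rw [← ENNReal.ofReal_mul (hc j)]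
    apply ENNReal.ofReal_le_ofReal
    have : c j * (1 / ((j : ℝ) + 1) * (D * ρ j ^ s)) = 1 / ((j : ℝ) + 1) := by
      have := (hρs j).ne'
      simp only [c]
      field_simp
    rw [this]
    exact hj2


/-! ## Blow-ups of uniform measures -/

lemma exists_ballK_of_isCompact {n : ℕ} {K : Set (Sp n)} (hK : IsCompact K) :
    ∃ R > 0, K ⊆ ballK (0 : Sp n) R := by
  obtain ⟨R, hR⟩ := (hK.image (continuous_dK_right (0 : Sp n))).bddAbove
  refine ⟨max R 1, by positivity, fun y hy => ?_⟩
  have : dK 0 y ≤ R := hR ⟨y, hy, rfl⟩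
  exact this.trans (le_max_left _ _)

lemma Unif.finite {n : ℕ} {s : ℝ} {S : Set (Sp n)} {ν : Measure (Sp n)} (h : Unif s S ν) :
    IsFiniteMeasureOnCompacts ν := by
  constructor
  intro K hK
  obtain ⟨R, hR0, hR⟩ := exists_ballK_of_isCompact hK
  refine (measure_mono hR).trans_lt ?_
  rw [h.ball 0 h.zero R hR0]
  exact ENNReal.ofReal_lt_top

lemma Unif.ae_mem {n : ℕ} {s : ℝ} {S : Set (Sp n)} {ν : Measure (Sp n)} (h : Unif s S ν) :
    ∀ᵐ y ∂ν, y ∈ S := h.null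

lemma Unif.blow {n : ℕ} {s : ℝ} {S : Set (Sp n)} {ν : Measure (Sp n)} (h : Unif s S ν)
    (p : Sp n) {r : ℝ} (hr : 0 < r) :
    (∀ x ∈ blow p r '' S, ∀ R > 0, bmeas ν p r (ENNReal.ofReal (r ^ s)) (ballK x R) =
      ENNReal.ofReal (R ^ s)) ∧ bmeas ν p r (ENNReal.ofReal (r ^ s)) (blow p r '' S)ᶜ = 0 := by
  constructor
  · rintro _ ⟨y, hy, rfl⟩ R hR
    rw [bmeas_ballK ν p hr, h.ball y hy _ (by positivity), ← ENNReal.ofReal_mul (by positivity),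
      Real.div_rpow hR.le hr.le]
    have : r ^ s ≠ 0 := (Real.rpow_pos_of_pos hr s).ne'
    field_simp
  · rw [bmeas_apply ν p hr]
    have : _root_.blow p r ⁻¹' (_root_.blow p r '' S)ᶜ ⊆ Sᶜ := by
      intro y hy hyS
      exact hy ⟨y, hyS, rfl⟩
    rw [measure_mono_null this h.null, mul_zero]

lemma blowup {n : ℕ} {s : ℝ} (hs : 0 < s) {S : Set (Sp n)} {ν : Measure (Sp n)} (h : Unif s S ν)
    {p : Sp n} (hp : p ∈ S) :
    ∃ S' ν', Unif s S' ν' ∧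
      (∀ V : Submodule ℝ (EuclideanSpace ℝ (Fin n)), (∀ z ∈ S, z.1 ∈ V) → ∀ z ∈ S', z.1 ∈ V) ∧
      ∀ (φ : Sp n → ℝ) (a : ℕ) (C ρ : ℝ), Continuous φ → 0 < ρ →
        (∀ r x, 0 < r → φ (dil r x) = r ^ a * φ x) →
        (∀ y ∈ S, dK p y ≤ ρ → -C * dK p y ^ (a + 1) ≤ φ (y - p)) → ∀ z ∈ S', 0 ≤ φ z := by
  let U : Ultrafilter ℕ := hyperfilter ℕ
  have hU : (U : Filter ℕ) ≤ atTop := Nat.hyperfilter_le_atTop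
  have hk : ∀ k : ℕ, (0 : ℝ) < (k : ℝ) + 1 := fun k => by positivity
  have hfin := h.finite
  let μ : ℕ → Measure (Sp n) := fun k => bmeas ν p ((k : ℝ) + 1)
    (ENNReal.ofReal (((k : ℝ) + 1) ^ s))
  have : ∀ k, IsFiniteMeasureOnCompacts (μ k) := fun k =>
    bmeas_finite ν p (hk k) ENNReal.ofReal_ne_top
  let A : ℕ → Set (Sp n) := fun k => blow p ((k : ℝ) + 1) '' S
  obtain ⟨ν', hν'⟩ := limit_lemma hs U μ A
    (fun j => ⟨p, hp, blow_self _ _⟩) (by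
      intro R hR ε hε
      refine Eventually.of_forall fun k x hx _ r hr _ => ?_
      rw [(h.blow p (hk k)).1 x hx r hr]
      have : 0 ≤ r ^ s := by positivity
      constructor <;> apply ENNReal.ofReal_le_ofReal <;> nlinarith) (by
      intro R hR ε hε
      refine Eventually.of_forall fun k => ?_
      rw [measure_mono_null (fun x hx => hx.2) (h.blow p (hk k)).2]
      exact zero_le)
  refine ⟨_, ν', hν', ?_, ?_⟩
  · intro V hV z hz
    by_contra hzV
    have ho : {x : Sp n | x.1 ∉ V} ∈ nhds z := by
      have : IsClosed {x : Sp n | x.1 ∈ V} :=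
        (Submodule.closed_of_finiteDimensional V).preimage continuous_fst
      exact this.isOpen_compl.mem_nhds hzV
    obtain ⟨ε, hε, hsub⟩ := exists_ballK_subset ho
    obtain ⟨k, y, ⟨w, hw, rfl⟩, hy⟩ := (hz ε hε).exists
    apply hsub (mem_ballK.2 hy.le)
    show ((k : ℝ) + 1) • (w - p).1 ∈ V
    exact V.smul_mem _ (V.sub_mem (hV w hw) (hV p hp))
  · intro φ a C ρ hφ hρ hhom hlow z hz
    by_contra hneg
    rw [not_le] at hneg
    have ho : {x : Sp n | φ x < φ z / 2} ∈ nhds z :=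
      (isOpen_lt hφ continuous_const).mem_nhds (show φ z < φ z / 2 by linarith)
    obtain ⟨ε, hε, hsub⟩ := exists_ballK_subset ho
    set M := dK 0 z + 1 with hM
    have hM0 : 0 < M := by linarith [dK_nonneg 0 z]
    have h1 : ∀ᶠ k : ℕ in (U : Filter ℕ), M / ρ ≤ (k : ℝ) :=
      hU (tendsto_natCast_atTop_atTop.eventually_ge_atTop _)
    have h2 : ∀ᶠ k : ℕ in (U : Filter ℕ), |C| * M ^ (a + 1) / (-φ z / 2) ≤ (k : ℝ) :=
      hU (tendsto_natCast_atTop_atTop.eventually_ge_atTop _)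
    obtain ⟨k, ⟨y, ⟨w, hw, rfl⟩, hy⟩, hk1, hk2⟩ :=
      ((hz (min ε 1) (by positivity)).and (h1.and h2)).exists
    have hyε := hy.le.trans (min_le_left _ _)
    have hy1 := hy.le.trans (min_le_right _ _)
    have hφy : φ (blow p ((k : ℝ) + 1) w) < φ z / 2 := hsub (mem_ballK.2 hyε)
    have hd : ((k : ℝ) + 1) * dK p w ≤ M := by
      rw [← dK_blow (hk k).le p, blow_self]
      linarith [dK_triangle 0 z (blow p ((k : ℝ) + 1) w)]
    have hd0 := dK_nonneg p w
    have hdρ : dK p w ≤ ρ := by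
      rw [div_le_iff₀ hρ] at hk1
      have : ((k : ℝ) + 1) * dK p w ≤ ((k : ℝ) + 1) * ρ := by nlinarith
      exact le_of_mul_le_mul_left this (hk k)
    have hl := hlow w hw hdρ
    unfold blow at hφy
    rw [hhom _ _ (hk k)] at hφy
    have e1 : ((k : ℝ) + 1) ^ a * (-C * dK p w ^ (a + 1)) ≤ ((k : ℝ) + 1) ^ a * φ (w - p) :=
      mul_le_mul_of_nonneg_left hl (by positivity)
    have e2 : ((k : ℝ) + 1) * (((k : ℝ) + 1) ^ a * (-C * dK p w ^ (a + 1))) =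
        -C * (((k : ℝ) + 1) * dK p w) ^ (a + 1) := by rw [mul_pow]; ring
    have e3 : (((k : ℝ) + 1) * dK p w) ^ (a + 1) ≤ M ^ (a + 1) :=
      pow_le_pow_left₀ (by positivity) hd _
    have e4 : 0 ≤ (((k : ℝ) + 1) * dK p w) ^ (a + 1) := by positivity
    have e5 : -(|C| * M ^ (a + 1)) ≤ -C * (((k : ℝ) + 1) * dK p w) ^ (a + 1) := by
      have := le_abs_self C
      have h0 := abs_nonneg C
      nlinarith
    rw [div_le_iff₀ (by linarith)] at hk2
    have e6 : ((k : ℝ) + 1) * (((k : ℝ) + 1) ^ a * φ (w - p)) < ((k : ℝ) + 1) * (φ z / 2) :=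
      mul_lt_mul_of_pos_left hφy (hk k)
    have e7 := mul_le_mul_of_nonneg_left e1 (hk k).le
    nlinarith

/-! ## Moment identities -/

lemma Unif.ball_nonpos {n : ℕ} {s : ℝ} (hs : 0 < s) {S : Set (Sp n)} {ν : Measure (Sp n)}
    (h : Unif s S ν) {x : Sp n} (hx : x ∈ S) {r : ℝ} (hr : r ≤ 0) : ν (ballK x r) = 0 := by
  have ht : Tendsto (fun e : ℝ => ENNReal.ofReal (e ^ s)) (nhdsWithin 0 (Ioi 0)) (nhds 0) := by
    have : ContinuousAt (fun e : ℝ => e ^ s) 0 :=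
      ContinuousAt.rpow_const continuousAt_id (Or.inr hs.le)
    have := this.tendsto.mono_left (nhdsWithin_le_nhds (s := Ioi 0))
    have := ENNReal.tendsto_ofReal this
    simpa [Real.zero_rpow hs.ne'] using this
  apply le_antisymm _ zero_le
  apply ge_of_tendsto ht
  filter_upwards [self_mem_nhdsWithin] with e he
  have he : 0 < e := he
  rw [← h.ball x hx e he]
  exact measure_mono (ballK_mono x (hr.trans he.le))

lemma Unif.integral_eq {n : ℕ} {s : ℝ} (hs : 0 < s) {S : Set (Sp n)} {ν : Measure (Sp n)}
    (h : Unif s S ν) {z : Sp n} (hz : z ∈ S) {g : ℝ → ℝ} (hg : Continuous g)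
    (hg0 : ∀ x, 1 < x → g x = 0) : ∫ y, g (dK z y) ∂ν = ∫ y, g (dK 0 y) ∂ν := by
  have hfin := h.finite
  have key : ∀ x ∈ S, ∫ y, g (dK x y) ∂ν =
      ∫ t, g t ∂((ν.restrict (ballK x 1)).map (fun y => dK x y)) := by
    intro x _
    rw [integral_map (continuous_dK_right x).aemeasurable hg.aestronglyMeasurable]
    rw [setIntegral_eq_integral_of_forall_compl_eq_zero]
    intro y hy
    apply hg0
    simpa [mem_ballK] using hy
  rw [key z hz, key 0 h.zero]
  congr 1
  have hf : ∀ x : Sp n, IsFiniteMeasure (ν.restrict (ballK x 1)) := fun x =>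
    ⟨by rw [Measure.restrict_apply_univ]; exact (isCompact_ballK x 1).measure_lt_top⟩
  have := hf z
  have hI : ∀ (x : Sp n) (t : ℝ), ((ν.restrict (ballK x 1)).map (fun y => dK x y)) (Iic t) =
      ν (ballK x (min t 1)) := by
    intro x t
    rw [Measure.map_apply (continuous_dK_right x).measurable measurableSet_Iic,
      Measure.restrict_apply' (measurableSet_ballK x 1)]
    congr 1
    ext y
    simp [mem_ballK]
  apply Measure.ext_of_Iic
  intro t
  rw [hI, hI]
  by_cases ht : 0 < min t 1
  · rw [h.ball z hz _ ht, h.ball 0 h.zero _ ht]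
  · rw [h.ball_nonpos hs hz (not_lt.1 ht), h.ball_nonpos hs h.zero (not_lt.1 ht)]

/-- The weight `(1 - d(0,y)^4)_+`. -/
def wt {n : ℕ} (y : Sp n) : ℝ := max (1 - dK 0 y ^ 4) 0

lemma continuous_wt {n : ℕ} : Continuous (wt : Sp n → ℝ) := by
  have := continuous_dK_right (0 : Sp n)
  unfold wt
  fun_prop

lemma wt_nonneg {n : ℕ} (y : Sp n) : 0 ≤ wt y := le_max_right _ _

lemma taylor_aux (a b : ℝ) :
    |max (1 - a) 0 ^ 2 - max (1 - b) 0 ^ 2 + 2 * max (1 - b) 0 * (a - b)| ≤ (a - b) ^ 2 := by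
  rw [abs_le]
  rcases le_total (1 - a) 0 with h1 | h1 <;> rcases le_total (1 - b) 0 with h2 | h2 <;>
    simp only [max_eq_left, max_eq_right, h1, h2] <;> constructor <;> nlinarith

lemma Unif.expansion {n : ℕ} {s : ℝ} (hs : 0 < s) {S : Set (Sp n)} {ν : Measure (Sp n)}
    (h : Unif s S ν) {z : Sp n} (hz : z ∈ S) (hz1 : dK 0 z ≤ 1) {l : Sp n → ℝ}
    (hl : Continuous l) {K η : ℝ} (hK : 0 ≤ K)
    (e1 : ∀ y ∈ ballK (0 : Sp n) 2, |dK z y ^ 4 - dK 0 y ^ 4 - l y| ≤ K * η ^ 2)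
    (e2 : ∀ y ∈ ballK (0 : Sp n) 2, |dK z y ^ 4 - dK 0 y ^ 4| ≤ K * η) :
    |∫ y in ballK 0 2, 2 * wt y * l y ∂ν| ≤
      (K ^ 2 + 2 * K) * (ν (ballK 0 2)).toReal * η ^ 2 := by
  have hfin := h.finite
  set B := ballK (0 : Sp n) 2 with hB
  let g : ℝ → ℝ := fun x => max (1 - |x| ^ 4) 0 ^ 2
  have hg : Continuous g := by fun_prop
  have hgd : ∀ x y : Sp n, g (dK x y) = max (1 - dK x y ^ 4) 0 ^ 2 := by
    intro x y
    simp only [g, abs_of_nonneg (dK_nonneg x y)]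
  have hg0 : ∀ x, 1 < x → g x = 0 := by
    intro x hx
    have : 1 ≤ |x| ^ 4 := one_le_pow₀ (hx.le.trans (le_abs_self x))
    simp only [g]
    rw [max_eq_right (by linarith)]
    norm_num
  have hIntg := h.integral_eq hs hz hg hg0
  have r1 : ∫ y in B, g (dK z y) ∂ν = ∫ y, g (dK z y) ∂ν := by
    apply setIntegral_eq_integral_of_forall_compl_eq_zero
    intro y hy
    apply hg0
    rw [mem_ballK, not_le] at hy
    linarith [dK_triangle 0 z y]
  have r2 : ∫ y in B, g (dK 0 y) ∂ν = ∫ y, g (dK 0 y) ∂ν := by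
    apply setIntegral_eq_integral_of_forall_compl_eq_zero
    intro y hy
    apply hg0
    rw [mem_ballK, not_le] at hy
    linarith
  have hBc : IsCompact B := isCompact_ballK _ _
  have i1 : IntegrableOn (fun y => g (dK z y)) B ν :=
    (hg.comp (continuous_dK_right z)).continuousOn.integrableOn_compact hBc
  have i2 : IntegrableOn (fun y => g (dK 0 y)) B ν :=
    (hg.comp (continuous_dK_right 0)).continuousOn.integrableOn_compact hBc
  have i3 : IntegrableOn (fun y => 2 * wt y * l y) B ν :=
    ((continuous_const.mul continuous_wt).mul hl).continuousOn.integrableOn_compact hBc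
  have i12 : IntegrableOn (fun y => g (dK z y) - g (dK 0 y)) B ν := i1.sub i2
  have r3 : ∫ y in B, 2 * wt y * l y ∂ν =
      ∫ y in B, (g (dK z y) - g (dK 0 y) + 2 * wt y * l y) ∂ν := by
    rw [integral_add i12 i3, integral_sub i1 i2, r1, r2, hIntg]
    ring
  rw [r3]
  have := norm_setIntegral_le_of_norm_le_const (μ := ν) (s := B)
    (f := fun y => g (dK z y) - g (dK 0 y) + 2 * wt y * l y) (C := (K ^ 2 + 2 * K) * η ^ 2)
    hBc.measure_lt_top (by
      intro y hy
      rw [Real.norm_eq_abs, hgd, hgd]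
      have t := taylor_aux (dK z y ^ 4) (dK 0 y ^ 4)
      have w0 := wt_nonneg y
      have w1 : wt y ≤ 1 := max_le (by have := dK_nonneg 0 y; nlinarith [pow_nonneg this 4]) one_pos.le
      have k1 := e1 y hy
      have k2 := e2 y hy
      change |_ - _ + 2 * wt y * _| ≤ _ at t
      generalize dK z y ^ 4 = a at *
      generalize hb : dK 0 y ^ 4 = b at *
      have q : (a - b) ^ 2 ≤ (K * η) ^ 2 := sq_le_sq' (by linarith [neg_abs_le (a - b)])
        (by linarith [le_abs_self (a - b)])
      have p : |2 * wt y * (l y - (a - b))| ≤ 2 * (K * η ^ 2) := by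
        rw [abs_mul, abs_of_nonneg (by positivity : 0 ≤ 2 * wt y), abs_sub_comm]
        have : 0 ≤ K * η ^ 2 := by positivity
        have h0 := abs_nonneg (a - b - l y)
        nlinarith
      have e : max (1 - a) 0 ^ 2 - max (1 - b) 0 ^ 2 + 2 * wt y * l y =
          (max (1 - a) 0 ^ 2 - max (1 - b) 0 ^ 2 + 2 * wt y * (a - b)) +
            2 * wt y * (l y - (a - b)) := by ring
      rw [e]
      refine (abs_add_le _ _).trans ?_
      nlinarith)
  rw [Real.norm_eq_abs] at this
  refine this.trans (le_of_eq ?_)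
  rw [Measure.real]
  ring


lemma bound_aux {q N p t u e : ℝ} (hq0 : 0 ≤ q) (hN0 : 0 ≤ N) (hN : N ≤ 2) (he : e ≤ 1)
    (hq : q ≤ e) (hp : |p| ≤ N * q) (ht : |t| ≤ e ^ 2) (hu : |u| ≤ 4) :
    |(q ^ 2 - 2 * p + N ^ 2) ^ 2 + (t - u) ^ 2 - (N ^ 4 + u ^ 2) - (-4 * N ^ 2 * p)| ≤
      100 * e ^ 2 ∧
    |(q ^ 2 - 2 * p + N ^ 2) ^ 2 + (t - u) ^ 2 - (N ^ 4 + u ^ 2)| ≤ 100 * e := by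
  have he0 : 0 ≤ e := hq0.trans hq
  have hp2 : |p| ≤ 2 * e := hp.trans (mul_le_mul hN hq hq0 (by norm_num))
  have hq2 : q ^ 2 ≤ e ^ 2 := pow_le_pow_left₀ hq0 hq 2
  have he2 : e ^ 2 ≤ e := by nlinarith
  have he1 : e ^ 2 ≤ 1 := by nlinarith
  have hpp : p ^ 2 ≤ (2 * e) ^ 2 := sq_le_sq' (by linarith [neg_abs_le p]) (by linarith [le_abs_self p])
  have htt : t ^ 2 ≤ (e ^ 2) ^ 2 := sq_le_sq' (by linarith [neg_abs_le t]) (by linarith [le_abs_self t])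
  have htu : |t * u| ≤ e ^ 2 * 4 := by
    rw [abs_mul]; exact mul_le_mul ht hu (abs_nonneg _) (by positivity)
  have hN2 : N ^ 2 ≤ 4 := by nlinarith
  have hNq : N ^ 2 * q ^ 2 ≤ 4 * e ^ 2 := mul_le_mul hN2 hq2 (by positivity) (by norm_num)
  have hpq : |p * q ^ 2| ≤ 2 * e ^ 2 := by
    rw [abs_mul, abs_of_nonneg (sq_nonneg q)]
    calc |p| * q ^ 2 ≤ (2 * e) * e ^ 2 := mul_le_mul hp2 hq2 (by positivity) (by positivity)
      _ ≤ 2 * e ^ 2 := by nlinarith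
  have hq4 : (q ^ 2) ^ 2 ≤ e ^ 2 := by nlinarith [sq_nonneg q]
  have ht4 : t ^ 2 ≤ e ^ 2 := by nlinarith [sq_nonneg e]
  have hNp : |N ^ 2 * p| ≤ 8 * e := by
    rw [abs_mul, abs_of_nonneg (sq_nonneg N)]
    calc N ^ 2 * |p| ≤ 4 * (2 * e) := mul_le_mul hN2 hp2 (abs_nonneg _) (by norm_num)
      _ = 8 * e := by ring
  have hNq0 : 0 ≤ N ^ 2 * q ^ 2 := by positivity
  rw [abs_le] at *
  have e1 : (q ^ 2 - 2 * p + N ^ 2) ^ 2 + (t - u) ^ 2 - (N ^ 4 + u ^ 2) =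
    -4 * (N ^ 2 * p) + (4 * p ^ 2 + 2 * (N ^ 2 * q ^ 2) - 4 * (p * q ^ 2) + (q ^ 2) ^ 2
      - 2 * (t * u) + t ^ 2) := by ring
  rw [abs_le, e1]
  have := sq_nonneg t
  have := sq_nonneg p
  have := sq_nonneg (q ^ 2)
  refine ⟨⟨?_, ?_⟩, ?_, ?_⟩ <;> nlinarith

lemma Unif.horiz {n : ℕ} {s : ℝ} (hs : 0 < s) {S : Set (Sp n)} {ν : Measure (Sp n)}
    (h : Unif s S ν) : ∃ C : ℝ, ∀ z ∈ S, dK 0 z ≤ 1 →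
      |∫ y in ballK 0 2, wt y * ‖y.1‖ ^ 2 * inner ℝ y.1 z.1 ∂ν| ≤ C * dK 0 z ^ 2 := by
  refine ⟨(100 ^ 2 + 2 * 100) * (ν (ballK 0 2)).toReal, ?_⟩
  intro z hz hz1
  have hb : ∀ y ∈ ballK (0 : Sp n) 2,
      |dK z y ^ 4 - dK 0 y ^ 4 - (-4 * ‖y.1‖ ^ 2 * inner ℝ y.1 z.1)| ≤ 100 * dK 0 z ^ 2 ∧
      |dK z y ^ 4 - dK 0 y ^ 4| ≤ 100 * dK 0 z := by
    intro y hy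
    have hy : dK 0 y ≤ 2 := hy
    have a1 := norm_le_dK 0 y
    have a2 := abs_le_dK 0 y
    have a3 := norm_le_dK 0 z
    have a4 := abs_le_dK 0 z
    simp only [Prod.fst_zero, Prod.snd_zero, zero_sub, norm_neg, abs_neg] at a1 a2 a3 a4
    have k := bound_aux (norm_nonneg z.1) (norm_nonneg y.1) (a1.trans hy) hz1 a3
      (abs_real_inner_le_norm y.1 z.1) a4
      (a2.trans (by have := pow_le_pow_left₀ (dK_nonneg 0 y) hy 2; linarith))
    have e : dK z y ^ 4 = (‖z.1‖ ^ 2 - 2 * inner ℝ y.1 z.1 + ‖y.1‖ ^ 2) ^ 2 + (z.2 - y.2) ^ 2 := by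
      rw [dK_pow, ← real_inner_comm, ← norm_sub_sq_real]
      ring
    have e0 : dK 0 y ^ 4 = ‖y.1‖ ^ 4 + y.2 ^ 2 := by
      rw [dK_pow]; simp
    rw [e, e0]
    exact k
  have := h.expansion hs hz hz1 (l := fun y => -4 * ‖y.1‖ ^ 2 * inner ℝ y.1 z.1)
    (by fun_prop) (K := 100) (η := dK 0 z) (by norm_num)
    (fun y hy => (hb y hy).1) (fun y hy => (hb y hy).2)
  have e : ∫ y in ballK 0 2, 2 * wt y * (-4 * ‖y.1‖ ^ 2 * inner ℝ y.1 z.1) ∂ν =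
      -8 * ∫ y in ballK 0 2, wt y * ‖y.1‖ ^ 2 * inner ℝ y.1 z.1 ∂ν := by
    rw [← integral_const_mul]
    congr 1
    ext y
    ring
  rw [e, abs_mul] at this
  refine le_trans ?_ this
  have := abs_nonneg (∫ y in ballK 0 2, wt y * ‖y.1‖ ^ 2 * inner ℝ y.1 z.1 ∂ν)
  norm_num
  linarith

lemma Unif.vert {n : ℕ} {s : ℝ} (hs : 0 < s) {S : Set (Sp n)} {ν : Measure (Sp n)}
    (h : Unif s S ν) : ∃ C : ℝ, ∀ t : ℝ, ((0, t) : Sp n) ∈ S → |t| ≤ 1 →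
      |t * ∫ y in ballK 0 2, wt y * y.2 ∂ν| ≤ C * t ^ 2 := by
  refine ⟨(9 ^ 2 + 2 * 9) * (ν (ballK 0 2)).toReal, ?_⟩
  intro t hz ht
  have hd : ∀ y : Sp n, dK (0, t) y ^ 4 = ‖y.1‖ ^ 4 + (t - y.2) ^ 2 := by
    intro y; rw [dK_pow]; simp
  have hd0 : ∀ y : Sp n, dK 0 y ^ 4 = ‖y.1‖ ^ 4 + y.2 ^ 2 := by
    intro y; rw [dK_pow]; simp
  have hz1 : dK (0 : Sp n) (0, t) ≤ 1 := by
    rw [dK_le_iff _ _ zero_le_one]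
    simpa using ht
  have hb : ∀ y ∈ ballK (0 : Sp n) 2,
      |dK (0, t) y ^ 4 - dK 0 y ^ 4 - (-2 * t * y.2)| ≤ 9 * |t| ^ 2 ∧
      |dK (0, t) y ^ 4 - dK 0 y ^ 4| ≤ 9 * |t| := by
    intro y hy
    have hy : dK 0 y ≤ 2 := hy
    have a2 := abs_le_dK 0 y
    simp only [Prod.snd_zero, zero_sub, abs_neg] at a2
    have a3 : |y.2| ≤ 4 := a2.trans (by have := pow_le_pow_left₀ (dK_nonneg 0 y) hy 2; linarith)
    rw [hd, hd0]
    have e1 : ‖y.1‖ ^ 4 + (t - y.2) ^ 2 - (‖y.1‖ ^ 4 + y.2 ^ 2) - -2 * t * y.2 = t ^ 2 := by ring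
    have e2 : ‖y.1‖ ^ 4 + (t - y.2) ^ 2 - (‖y.1‖ ^ 4 + y.2 ^ 2) = t * (t - 2 * y.2) := by ring
    rw [e1, e2, sq_abs, abs_of_nonneg (sq_nonneg t), abs_mul]
    constructor
    · nlinarith [sq_nonneg t]
    · have : |t - 2 * y.2| ≤ 9 := by
        rw [abs_le] at *
        constructor <;> linarith
      nlinarith [abs_nonneg t]
  have := h.expansion hs hz hz1 (l := fun y => -2 * t * y.2)
    (by fun_prop) (K := 9) (η := |t|) (by norm_num)
    (fun y hy => (hb y hy).1) (fun y hy => (hb y hy).2)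
  have e : ∫ y in ballK (0 : Sp n) 2, 2 * wt y * (-2 * t * y.2) ∂ν =
      -4 * (t * ∫ y in ballK 0 2, wt y * y.2 ∂ν) := by
    rw [← integral_const_mul, ← integral_const_mul]
    congr 1
    ext y
    ring
  rw [e, abs_mul, sq_abs] at this
  refine le_trans ?_ this
  have := abs_nonneg (t * ∫ y in ballK (0 : Sp n) 2, wt y * y.2 ∂ν)
  rw [show |(-4 : ℝ)| = 4 by norm_num]
  linarith

/-- A nonnegative continuous function with vanishing integral vanishes on the support. -/
lemma Unif.eq_zero_of_integral {n : ℕ} {s : ℝ} {S : Set (Sp n)} {ν : Measure (Sp n)}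
    (h : Unif s S ν) {f : Sp n → ℝ} (hf : Continuous f) (hf0 : ∀ y ∈ S, 0 ≤ f y)
    (hi : ∫ y in ballK 0 2, f y ∂ν = 0) {y : Sp n} (hy : y ∈ S) (hy1 : dK 0 y < 2) : f y = 0 := by
  have hfin := h.finite
  have hae : 0 ≤ᵐ[ν.restrict (ballK 0 2)] f := by
    apply ae_restrict_of_ae
    filter_upwards [h.ae_mem] with y hy using hf0 y hy
  rw [setIntegral_eq_zero_iff_of_nonneg_ae hae
    (hf.continuousOn.integrableOn_compact (isCompact_ballK _ _))] at hi
  by_contra hne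
  have ho : {x : Sp n | f x ≠ 0} ∩ {x | dK 0 x < 2} ∈ nhds y :=
    ((isOpen_ne_fun hf continuous_const).inter (isOpen_oball 0 2)).mem_nhds ⟨hne, hy1⟩
  obtain ⟨ε, hε, hsub⟩ := exists_ballK_subset ho
  have hb := h.ball y hy ε hε
  have hz : ν (ballK y ε) = 0 := by
    rw [Filter.EventuallyEq, ae_restrict_iff' (measurableSet_ballK _ _)] at hi
    refine measure_mono_null (fun x hx => ?_) hi
    have h1 : f x ≠ 0 := (hsub hx).1
    have h2 : dK 0 x < 2 := (hsub hx).2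
    intro hcon
    exact h1 (hcon (mem_ballK.2 h2.le))
  rw [hz] at hb
  have : 0 < ε ^ s := Real.rpow_pos_of_pos hε s
  have := ENNReal.ofReal_pos.2 this
  exact this.ne hb


/-! ## Minimal subspaces -/

/-- `V` is minimal among the subspaces `W` such that some `s`-uniform measure lives in `W × ℝ`. -/
def MinV {n : ℕ} (s : ℝ) (V : Submodule ℝ (EuclideanSpace ℝ (Fin n))) : Prop :=
  ∀ W < V, ∀ (S : Set (Sp n)) (ν : Measure (Sp n)), Unif s S ν → ¬ ∀ z ∈ S, z.1 ∈ W

lemma dil_inner {n : ℕ} (e : EuclideanSpace ℝ (Fin n)) (r : ℝ) (x : Sp n) :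
    inner ℝ e (dil r x).1 = r ^ 1 * inner ℝ e x.1 := by
  simp [dil, inner_smul_right]

lemma MinV.eq_zero {n : ℕ} {s : ℝ} (hs : 0 < s) {V : Submodule ℝ (EuclideanSpace ℝ (Fin n))}
    (hV : MinV s V) {S : Set (Sp n)} {ν : Measure (Sp n)} (h : Unif s S ν)
    (hSV : ∀ z ∈ S, z.1 ∈ V) {e : EuclideanSpace ℝ (Fin n)} (he : e ∈ V) {C ρ : ℝ} (hρ : 0 < ρ)
    (hC : ∀ z ∈ S, dK 0 z ≤ ρ → |inner ℝ e z.1| ≤ C * dK 0 z ^ 2) : e = 0 := by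
  by_contra hne
  obtain ⟨S', ν', h', hV', hφ⟩ := blowup hs h h.zero
  have p1 := hφ (fun z => inner ℝ e z.1) 1 C ρ (by fun_prop) hρ (fun r x _ => dil_inner e r x)
    (by
      intro y hy hy1
      have := (abs_le.1 (hC y hy hy1)).1
      simp only [sub_zero]
      rw [show (1 + 1 : ℕ) = 2 from rfl]
      linarith)
  have p2 := hφ (fun z => inner ℝ (-e) z.1) 1 C ρ (by fun_prop) hρ
    (fun r x _ => dil_inner (-e) r x)
    (by
      intro y hy hy1
      have := (abs_le.1 (hC y hy hy1)).2
      simp only [sub_zero, inner_neg_left]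
      rw [show (1 + 1 : ℕ) = 2 from rfl]
      linarith)
  apply hV (V ⊓ (Submodule.span ℝ {e})ᗮ) _ S' ν' h'
  · intro z hz
    refine ⟨hV' V hSV z hz, ?_⟩
    show z.1 ∈ (Submodule.span ℝ {e})ᗮ
    rw [Submodule.mem_orthogonal_singleton_iff_inner_right]
    have q1 := p1 z hz
    have q2 := p2 z hz
    simp only [inner_neg_left] at q2
    linarith
  · refine lt_of_le_of_ne inf_le_left fun heq => ?_
    have : e ∈ V ⊓ (Submodule.span ℝ {e})ᗮ := by rw [heq]; exact he
    have h2 : e ∈ (Submodule.span ℝ {e})ᗮ := this.2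
    rw [Submodule.mem_orthogonal_singleton_iff_inner_right] at h2
    exact hne (inner_self_eq_zero.1 h2)

lemma MinV.moment {n : ℕ} {s : ℝ} (hs : 0 < s) {V : Submodule ℝ (EuclideanSpace ℝ (Fin n))}
    (hV : MinV s V) {S : Set (Sp n)} {ν : Measure (Sp n)} (h : Unif s S ν)
    (hSV : ∀ z ∈ S, z.1 ∈ V) (e : EuclideanSpace ℝ (Fin n)) :
    ∫ y in ballK 0 2, wt y * ‖y.1‖ ^ 2 * inner ℝ y.1 e ∂ν = 0 := by
  have hfin := h.finite
  set b : EuclideanSpace ℝ (Fin n) := ∫ y in ballK 0 2, (wt y * ‖y.1‖ ^ 2) • y.1 ∂ν with hb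
  have hw := continuous_wt (n := n)
  have hIntg : IntegrableOn (fun y : Sp n => (wt y * ‖y.1‖ ^ 2) • y.1) (ballK 0 2) ν := by
    apply ContinuousOn.integrableOn_compact (isCompact_ballK _ _)
    exact Continuous.continuousOn (by fun_prop)
  have hbe : ∀ e : EuclideanSpace ℝ (Fin n), inner ℝ e b =
      ∫ y in ballK 0 2, wt y * ‖y.1‖ ^ 2 * inner ℝ y.1 e ∂ν := by
    intro e
    rw [hb, ← integral_inner hIntg]
    congr 1
    ext y
    rw [inner_smul_right, real_inner_comm]
  have hbV : b ∈ V := by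
    rw [← V.orthogonal_orthogonal, Submodule.mem_orthogonal]
    intro u hu
    rw [hbe u]
    apply integral_eq_zero_of_ae
    apply ae_restrict_of_ae
    filter_upwards [h.ae_mem] with y hy
    rw [Submodule.mem_orthogonal] at hu
    simp [hu y.1 (hSV y hy)]
  obtain ⟨C, hC⟩ := h.horiz hs
  have hb0 : b = 0 := by
    apply hV.eq_zero hs h hSV hbV one_pos (C := C)
    intro z hz hz1
    rw [real_inner_comm, hbe]
    exact hC z hz hz1
  rw [← hbe, hb0, inner_zero_right]

lemma wt_pos {n : ℕ} {y : Sp n} (hy : dK 0 y < 1) : 0 < wt y := by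
  apply lt_max_of_lt_left
  have := pow_lt_one₀ (dK_nonneg 0 y) hy (n := 4) (by norm_num)
  linarith

lemma MinV.no_half {n : ℕ} {s : ℝ} (hs : 0 < s) {V : Submodule ℝ (EuclideanSpace ℝ (Fin n))}
    (hV : MinV s V) {S : Set (Sp n)} {ν : Measure (Sp n)} (h : Unif s S ν)
    (hSV : ∀ z ∈ S, z.1 ∈ V) {e : EuclideanSpace ℝ (Fin n)} (he : e ∈ V)
    (hpos : ∀ z ∈ S, 0 ≤ inner ℝ e z.1) : e = 0 := by
  have hw := continuous_wt (n := n)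
  have hm := hV.moment hs h hSV e
  apply hV.eq_zero hs h hSV he (ρ := 1 / 2) (by norm_num) (C := 0)
  intro z hz hz1
  rw [zero_mul]
  have := h.eq_zero_of_integral (f := fun y => wt y * ‖y.1‖ ^ 2 * inner ℝ y.1 e)
    (by fun_prop) (by
      intro y hy
      have h1 := hpos y hy
      rw [real_inner_comm] at h1
      have h2 := wt_nonneg y
      positivity) hm hz (by linarith)
  rcases mul_eq_zero.1 this with h1 | h1
  · rcases mul_eq_zero.1 h1 with h2 | h2
    · exact absurd h2 (wt_pos (by linarith)).ne'
    · have : z.1 = 0 := by simpa using h2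
      simp [this]
  · rw [real_inner_comm, h1, abs_zero]

/-- The support is a product. -/
lemma MinV.product {n : ℕ} {s : ℝ} (hs : 0 < s) {V : Submodule ℝ (EuclideanSpace ℝ (Fin n))}
    (hV : MinV s V) {S : Set (Sp n)} {ν : Measure (Sp n)} (h : Unif s S ν)
    (hSV : ∀ z ∈ S, z.1 ∈ V) {q : Sp n} (hq : q ∈ S) {x : EuclideanSpace ℝ (Fin n)} (hx : x ∈ V) :
    ((x, q.2) : Sp n) ∈ S := by
  by_contra hnot
  set t := q.2 with ht
  obtain ⟨b, hb, hsub⟩ := Metric.isOpen_iff.1 h.closed.isOpen_compl (x, t) hnot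
  set κ : ℝ := (‖q.1 - x‖ ^ 2 + 1) / b ^ 2 with hκ
  have hκ0 : 0 < κ := by positivity
  have hκb : κ * b ^ 2 = ‖q.1 - x‖ ^ 2 + 1 := by
    rw [hκ]; field_simp
  let f : Sp n → ℝ := fun y => ‖y.1 - x‖ ^ 2 + κ * (y.2 - t) ^ 2
  have hf : Continuous f := by fun_prop
  -- a minimizer on `S`
  obtain ⟨p, hp, hmin⟩ : ∃ p ∈ S, ∀ y ∈ S, f p ≤ f y := by
    have hK : IsCompact (S ∩ {y | f y ≤ f q}) := by
      have hcl : IsClosed (S ∩ {y | f y ≤ f q}) :=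
        h.closed.inter (isClosed_le hf continuous_const)
      have hc : IsCompact (Metric.closedBall x (f q + 1) ×ˢ Metric.closedBall t (f q / κ + 1)) :=
        (isCompact_closedBall _ _).prod (isCompact_closedBall _ _)
      apply hc.of_isClosed_subset hcl
      rintro y ⟨-, hy⟩
      have hy : ‖y.1 - x‖ ^ 2 + κ * (y.2 - t) ^ 2 ≤ f q := hy
      have h2 : 0 ≤ κ * (y.2 - t) ^ 2 := by positivity
      refine ⟨?_, ?_⟩
      · rw [Metric.mem_closedBall, dist_eq_norm]
        nlinarith [sq_nonneg (‖y.1 - x‖ - 1), norm_nonneg (y.1 - x)]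
      · rw [Metric.mem_closedBall, Real.dist_eq]
        have h3 : (y.2 - t) ^ 2 ≤ f q / κ := by
          rw [le_div_iff₀ hκ0]
          nlinarith [sq_nonneg ‖y.1 - x‖]
        rw [← sq_abs] at h3
        nlinarith [sq_nonneg (|y.2 - t| - 1), abs_nonneg (y.2 - t)]
    obtain ⟨p, hp, hpm⟩ := hK.exists_isMinOn ⟨q, hq, le_refl (f q)⟩ hf.continuousOn
    refine ⟨p, hp.1, fun y hy => ?_⟩
    by_cases hyq : f y ≤ f q
    · exact hpm ⟨hy, hyq⟩
    · have : f p ≤ f q := hp.2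
      linarith
  set e := p.1 - x with he
  have heV : e ∈ V := V.sub_mem (hSV p hp) hx
  have he0 : e ≠ 0 := by
    intro h0
    have hpx : p.1 = x := sub_eq_zero.1 h0
    have h1 : f p ≤ f q := hmin q hq
    have h2 : κ * (p.2 - t) ^ 2 < κ * b ^ 2 := by
      have h3 : ‖p.1 - x‖ ^ 2 + κ * (p.2 - t) ^ 2 ≤ ‖q.1 - x‖ ^ 2 + κ * (q.2 - t) ^ 2 := h1
      rw [← he, h0, ← ht] at h3
      simp only [norm_zero, sub_self] at h3
      rw [hκb]
      nlinarith
    have h4 : (p.2 - t) ^ 2 < b ^ 2 := lt_of_mul_lt_mul_left h2 hκ0.le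
    have h5 : |p.2 - t| < b := abs_lt_of_sq_lt_sq h4 hb.le
    refine hsub ?_ hp
    rw [Metric.mem_ball, Prod.dist_eq, max_lt_iff]
    refine ⟨?_, ?_⟩
    · simpa [hpx] using hb
    · simpa [Real.dist_eq] using h5
  obtain ⟨S', ν', h', hV', hφ⟩ := blowup hs h hp
  apply he0
  refine hV.no_half hs h' (hV' V hSV) heV ?_
  apply hφ (fun z => inner ℝ e z.1) 1 (1 + 2 * κ * |p.2 - t| + κ) 1 (by fun_prop) one_pos
    (fun r x _ => dil_inner e r x)
  intro y hy hy1
  have h1 : ‖p.1 - x‖ ^ 2 + κ * (p.2 - t) ^ 2 ≤ ‖y.1 - x‖ ^ 2 + κ * (y.2 - t) ^ 2 := hmin y hy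
  have e1 : y.1 - x = e + (y.1 - p.1) := by rw [he]; abel
  rw [e1, norm_add_sq_real, ← he] at h1
  have e2 : y.2 - t = (p.2 - t) + (y.2 - p.2) := by ring
  rw [e2] at h1
  show _ ≤ inner ℝ e (y.1 - p.1)
  have a1 := norm_le_dK y p
  have a2 := abs_le_dK y p
  rw [dK_comm y p] at a1 a2
  have d0 := dK_nonneg p y
  generalize dK p y = d at *
  have b1 : ‖y.1 - p.1‖ ^ 2 ≤ d ^ 2 := pow_le_pow_left₀ (norm_nonneg _) a1 2
  generalize y.2 - p.2 = u at *
  generalize p.2 - t = v at *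
  have d2 : d ^ 2 ≤ 1 := by nlinarith
  have b2 : u ^ 2 ≤ d ^ 2 := by
    have : u ^ 2 ≤ (d ^ 2) ^ 2 := sq_le_sq' (by linarith [neg_abs_le u]) (by linarith [le_abs_self u])
    nlinarith
  have b3 : v * u ≤ |v| * d ^ 2 := by
    refine (le_abs_self _).trans ?_
    rw [abs_mul]
    exact mul_le_mul_of_nonneg_left a2 (abs_nonneg v)
  have b4 : κ * (v * u) ≤ κ * (|v| * d ^ 2) := mul_le_mul_of_nonneg_left b3 hκ0.le
  have b5 : κ * u ^ 2 ≤ κ * d ^ 2 := mul_le_mul_of_nonneg_left b2 hκ0.le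
  have b6 : 0 ≤ κ * (|v| * d ^ 2) := by positivity
  have b7 : 0 ≤ κ * d ^ 2 := by positivity
  rw [show (1 + 1 : ℕ) = 2 from rfl]
  nlinarith


/-! ## The vertical direction -/

lemma one_sided {T : Set ℝ} (hT : IsClosed T) (h0 : (0 : ℝ) ∈ T) (hne : T ≠ univ) :
    ∃ σ τ ρ : ℝ, (σ = 1 ∨ σ = -1) ∧ τ ∈ T ∧ 0 < ρ ∧ ∀ t ∈ T, |t - τ| ≤ ρ → 0 ≤ σ * (t - τ) := by
  obtain ⟨t1, ht1⟩ := (ne_univ_iff_exists_notMem T).1 hne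
  rcases lt_trichotomy 0 t1 with hlt | heq | hlt
  · have hcl : IsClosed (T ∩ Iic t1) := hT.inter isClosed_Iic
    have hbd : BddAbove (T ∩ Iic t1) := ⟨t1, fun x hx => hx.2⟩
    have hmem := hcl.csSup_mem ⟨0, h0, hlt.le⟩ hbd
    set τ := sSup (T ∩ Iic t1) with hτ
    have hτ1 : τ ≤ t1 := hmem.2
    have hτ2 : τ < t1 := lt_of_le_of_ne hτ1 fun h => ht1 (h ▸ hmem.1)
    refine ⟨-1, τ, t1 - τ, Or.inr rfl, hmem.1, by linarith, fun t ht htt => ?_⟩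
    have h1 : t ≤ t1 := by linarith [le_abs_self (t - τ)]
    have h2 : t ≤ τ := le_csSup hbd ⟨ht, h1⟩
    linarith
  · exact absurd (heq ▸ h0) ht1
  · have hcl : IsClosed (T ∩ Ici t1) := hT.inter isClosed_Ici
    have hbd : BddBelow (T ∩ Ici t1) := ⟨t1, fun x hx => hx.2⟩
    have hmem := hcl.csInf_mem ⟨0, h0, hlt.le⟩ hbd
    set τ := sInf (T ∩ Ici t1) with hτ
    have hτ1 : t1 ≤ τ := hmem.2
    have hτ2 : t1 < τ := lt_of_le_of_ne hτ1 fun h => ht1 (h ▸ hmem.1)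
    refine ⟨1, τ, τ - t1, Or.inl rfl, hmem.1, by linarith, fun t ht htt => ?_⟩
    have h1 : t1 ≤ t := by linarith [neg_abs_le (t - τ)]
    have h2 : τ ≤ t := csInf_le hbd ⟨ht, h1⟩
    linarith

lemma dil_vert {n : ℕ} (σ r : ℝ) (x : Sp n) : σ * (dil r x).2 = r ^ 2 * (σ * x.2) := by
  simp only [dil]; ring

lemma abs_snd_le {n : ℕ} (z : Sp n) : |z.2| ≤ dK 0 z ^ 2 := by
  have := abs_le_dK 0 z
  simpa using this

lemma MinV.dichotomy {n : ℕ} {s : ℝ} (hs : 0 < s) {V : Submodule ℝ (EuclideanSpace ℝ (Fin n))}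
    (hV : MinV s V) {S : Set (Sp n)} {ν : Measure (Sp n)} (h : Unif s S ν)
    (hSV : ∀ z ∈ S, z.1 ∈ V) :
    ∃ (S' : Set (Sp n)) (ν' : Measure (Sp n)), Unif s S' ν' ∧
      ((∀ z, z ∈ S' ↔ z.1 ∈ V) ∨ (∀ z, z ∈ S' ↔ z.1 ∈ V ∧ z.2 = 0)) := by
  let T : Set ℝ := {t | ((0, t) : Sp n) ∈ S}
  have hTcl : IsClosed T := h.closed.preimage (f := fun t : ℝ => ((0, t) : Sp n)) (by fun_prop)
  by_cases hT : T = univ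
  · refine ⟨S, ν, h, Or.inl fun z => ⟨hSV z, fun hz => ?_⟩⟩
    have h1 : z.2 ∈ T := hT ▸ mem_univ _
    have h2 : ((0, z.2) : Sp n) ∈ S := h1
    exact hV.product hs h hSV h2 hz
  obtain ⟨σ, τ, ρ, hσ, hτ, hρ, hside⟩ := one_sided hTcl h.zero hT
  have hτS : ((0, τ) : Sp n) ∈ S := hτ
  obtain ⟨S1, ν1, h1, hV1, hφ1⟩ := blowup hs h hτS
  have hS1V := hV1 V hSV
  have hpos : ∀ z ∈ S1, 0 ≤ σ * z.2 := by
    apply hφ1 (fun z => σ * z.2) 2 0 (√ρ) (by fun_prop) (Real.sqrt_pos.2 hρ)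
      (fun r x _ => dil_vert σ r x)
    intro y hy hd
    have hyT : ((0, y.2) : Sp n) ∈ S := hV.product hs h hSV hy V.zero_mem
    have a1 := abs_le_dK (0, τ) y
    have a2 : dK (0, τ) y ^ 2 ≤ ρ := by
      have := pow_le_pow_left₀ (dK_nonneg (0, τ) y) hd 2
      rwa [Real.sq_sqrt hρ.le] at this
    have := hside y.2 hyT (by rw [abs_sub_comm]; exact a1.trans a2)
    simpa using this
  have hw := continuous_wt (n := n)
  -- near `0` the second coordinate vanishes
  have hnear : ∃ ρ' > 0, ∀ z ∈ S1, dK 0 z ≤ ρ' → z.2 = 0 := by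
    have hσ0 : σ ≠ 0 := by rcases hσ with rfl | rfl <;> norm_num
    by_cases hc : ∫ y in ballK 0 2, wt y * y.2 ∂ν1 = 0
    · refine ⟨1 / 2, by norm_num, fun z hz hz1 => ?_⟩
      have := h1.eq_zero_of_integral (f := fun y => wt y * (σ * y.2)) (by fun_prop)
        (fun y hy => mul_nonneg (wt_nonneg y) (hpos y hy)) (by
          have : ∀ y : Sp n, wt y * (σ * y.2) = σ * (wt y * y.2) := fun y => by ring
          simp only [this]
          rw [integral_const_mul, hc, mul_zero]) hz (by linarith)
      have hwp := wt_pos (y := z) (by linarith)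
      rcases mul_eq_zero.1 this with h2 | h2
      · exact absurd h2 hwp.ne'
      · exact (mul_eq_zero.1 h2).resolve_left hσ0
    · obtain ⟨C, hC⟩ := h1.vert hs
      set c := ∫ y in ballK 0 2, wt y * y.2 ∂ν1 with hcdef
      have hc0 : 0 < |c| := abs_pos.2 hc
      have hC1 : 0 < |C| + 1 := by positivity
      set m := min 1 (|c| / (2 * (|C| + 1))) with hm
      have hm0 : 0 < m := lt_min one_pos (by positivity)
      refine ⟨√m, Real.sqrt_pos.2 hm0, fun z hz hz1 => ?_⟩
      have b1 : |z.2| ≤ m := by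
        refine (abs_snd_le z).trans ?_
        have := pow_le_pow_left₀ (dK_nonneg 0 z) hz1 2
        rwa [Real.sq_sqrt hm0.le] at this
      have b2 := hC z.2 (hV.product hs h1 hS1V hz V.zero_mem) (b1.trans (min_le_left _ _))
      by_contra hne
      have b3 : 0 < |z.2| := abs_pos.2 hne
      have b4 : |z.2| ≤ |c| / (2 * (|C| + 1)) := b1.trans (min_le_right _ _)
      rw [le_div_iff₀ (by positivity)] at b4
      rw [abs_mul, ← sq_abs z.2] at b2
      have b5 : |z.2| * |c| ≤ |z.2| * (C * |z.2|) := by linarith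
      have b6 := le_of_mul_le_mul_left b5 b3
      have b7 : C * |z.2| ≤ |C| * |z.2| := mul_le_mul_of_nonneg_right (le_abs_self C) b3.le
      nlinarith
  obtain ⟨ρ', hρ', hz0⟩ := hnear
  obtain ⟨S2, ν2, h2, hV2, hφ2⟩ := blowup hs h1 h1.zero
  have hS2V := hV2 V hS1V
  have key : ∀ σ' : ℝ, ∀ z ∈ S2, 0 ≤ σ' * z.2 := by
    intro σ'
    apply hφ2 (fun z => σ' * z.2) 2 0 ρ' (by fun_prop) hρ' (fun r x _ => dil_vert σ' r x)
    intro y hy hd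
    simp [hz0 y hy hd]
  refine ⟨S2, ν2, h2, Or.inr fun z => ⟨fun hz => ⟨hS2V z hz, ?_⟩, fun hz => ?_⟩⟩
  · have k1 := key 1 z hz
    have k2 := key (-1) z hz
    linarith
  · have := hV.product hs h2 hS2V h2.zero hz.1
    have e : z = (z.1, (0 : Sp n).2) := Prod.ext rfl hz.2
    rwa [e]


/-! ## Comparing dimensions -/

lemma rpow_compare {a b N M : ℝ} (hN : 0 < N) (h : ∀ r : ℝ, 0 < r → r ≤ 1 → N * r ^ b ≤ M * r ^ a) :
    a ≤ b := by
  by_contra! hab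
  have ht : Tendsto (fun r : ℝ => M * r ^ (a - b)) (nhdsWithin 0 (Ioi 0)) (nhds (M * 0)) := by
    apply Filter.Tendsto.const_mul
    have : ContinuousAt (fun r : ℝ => r ^ (a - b)) 0 :=
      Real.continuousAt_rpow_const _ _ (Or.inr (by linarith))
    have h2 := this.tendsto.mono_left (nhdsWithin_le_nhds (s := Ioi (0 : ℝ)))
    rwa [Real.zero_rpow (by linarith)] at h2
  rw [mul_zero] at ht
  have h1 := ht.eventually (gt_mem_nhds hN)
  have h2 : ∀ᶠ r : ℝ in nhdsWithin 0 (Ioi 0), r < 1 :=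
    nhdsWithin_le_nhds (gt_mem_nhds one_pos)
  obtain ⟨r, hr1, hr2, hr0⟩ := (h1.and (h2.and self_mem_nhdsWithin)).exists
  have hr0 : 0 < r := hr0
  have h3 := h r hr0 hr2.le
  rw [show a = (a - b) + b by ring, Real.rpow_add hr0] at h3
  have h4 := Real.rpow_pos_of_pos hr0 b
  have h5 : N * r ^ b ≤ (M * r ^ (a - b)) * r ^ b := by linarith
  have := le_of_mul_le_mul_right h5 h4
  linarith

lemma cmp_dim {n : ℕ} {S : Set (Sp n)} {ν ξ : Measure (Sp n)} [IsFiniteMeasureOnCompacts ν]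
    [IsFiniteMeasureOnCompacts ξ] (hν : ν Sᶜ = 0) (hξ : ξ Sᶜ = 0) {a b A c : ℝ} (hc : 0 < c)
    (h1 : ∀ x ∈ S, ∀ r > 0, ν (ballK x r) ≤ ENNReal.ofReal (A * r ^ a))
    (h2 : ∀ x ∈ S, ∀ r > 0, ENNReal.ofReal (c * r ^ b) ≤ ξ (ballK x r))
    (h0 : 0 < ν (ballK 0 1)) : a ≤ b := by
  have hN := (isCompact_ballK (0 : Sp n) 1).measure_lt_top (μ := ν)
  have hM := (isCompact_ballK (0 : Sp n) 2).measure_lt_top (μ := ξ)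
  apply rpow_compare (N := c * (ν (ballK 0 1)).toReal) (M := max A 0 * (ξ (ballK 0 2)).toReal)
    (mul_pos hc (ENNReal.toReal_pos h0.ne' hN.ne))
  intro r hr hr1
  have hra := Real.rpow_pos_of_pos hr a
  have hrb := Real.rpow_pos_of_pos hr b
  let E : Set (Sp n × Sp n) := {p | dK 0 p.1 ≤ 1 ∧ dK p.1 p.2 ≤ r}
  have hE : MeasurableSet E := by
    apply IsClosed.measurableSet
    apply IsClosed.inter
    · exact isClosed_le ((continuous_dK_right 0).comp continuous_fst) continuous_const
    · exact isClosed_le continuous_dK continuous_const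
  have e1 : ENNReal.ofReal (c * r ^ b) * ν (ballK 0 1) ≤ (ν.prod ξ) E := by
    rw [Measure.prod_apply hE, ← setLIntegral_const]
    rw [← lintegral_indicator (measurableSet_ballK _ _)]
    apply lintegral_mono_ae
    have : ∀ᵐ x ∂ν, x ∈ S := hν
    filter_upwards [this] with x hx
    by_cases hx1 : x ∈ ballK 0 1
    · rw [indicator_of_mem hx1]
      refine (h2 x hx r hr).trans (measure_mono fun y hy => ?_)
      exact ⟨hx1, hy⟩
    · rw [indicator_of_notMem hx1]; exact zero_le
  have e2 : (ν.prod ξ) E ≤ ENNReal.ofReal (max A 0 * r ^ a) * ξ (ballK 0 2) := by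
    rw [Measure.prod_apply_symm hE, ← setLIntegral_const]
    rw [← lintegral_indicator (measurableSet_ballK _ _)]
    apply lintegral_mono_ae
    have : ∀ᵐ x ∂ξ, x ∈ S := hξ
    filter_upwards [this] with y hy
    by_cases hy1 : y ∈ ballK 0 2
    · rw [indicator_of_mem hy1]
      refine le_trans (measure_mono fun x hx => ?_) ((h1 y hy r hr).trans
        (ENNReal.ofReal_le_ofReal (mul_le_mul_of_nonneg_right (le_max_left _ _) hra.le)))
      have hx2 : dK x y ≤ r := hx.2
      rw [mem_ballK, dK_comm]; exact hx2
    · rw [indicator_of_notMem hy1]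
      refine le_of_eq ?_
      convert measure_empty (μ := ν)
      refine eq_empty_of_forall_notMem fun x hx => hy1 ?_
      have hx1 : dK 0 x ≤ 1 := hx.1
      have hx2 : dK x y ≤ r := hx.2
      have := dK_triangle 0 x y
      rw [mem_ballK]; linarith
  have e3 := ENNReal.toReal_mono (ENNReal.mul_ne_top ENNReal.ofReal_ne_top hM.ne) (e1.trans e2)
  rw [ENNReal.toReal_mul, ENNReal.toReal_mul, ENNReal.toReal_ofReal (by positivity),
    ENNReal.toReal_ofReal (by positivity)] at e3
  linarith

lemma Unif.dim_eq {n : ℕ} {s : ℝ} {S : Set (Sp n)} {ν : Measure (Sp n)} (h : Unif s S ν)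
    {ξ : Measure (Sp n)} (hξ : ξ Sᶜ = 0) {b A c : ℝ} (hc : 0 < c)
    (h1 : ∀ x ∈ S, ∀ r > 0, ξ (ballK x r) ≤ ENNReal.ofReal (A * r ^ b))
    (h2 : ∀ x ∈ S, ∀ r > 0, ENNReal.ofReal (c * r ^ b) ≤ ξ (ballK x r)) : s = b := by
  have hfin := h.finite
  have hfin' : IsFiniteMeasureOnCompacts ξ := by
    refine ⟨fun K hK => ?_⟩
    obtain ⟨R, hR0, hR⟩ := exists_ballK_of_isCompact hK
    exact ((measure_mono hR).trans (h1 0 h.zero R hR0)).trans_lt ENNReal.ofReal_lt_top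
  apply le_antisymm
  · refine cmp_dim h.null hξ hc (A := 1) (fun x hx r hr => ?_) h2 ?_
    · rw [h.ball x hx r hr, one_mul]
    · rw [h.ball 0 h.zero 1 one_pos]; simp
  · refine cmp_dim hξ h.null one_pos h1 (fun x hx r hr => ?_) ?_
    · rw [h.ball x hx r hr, one_mul]
    · refine lt_of_lt_of_le ?_ (h2 0 h.zero 1 one_pos)
      simpa using hc

lemma Unif.dim_flat {n : ℕ} {s : ℝ} {S : Set (Sp n)} {ν : Measure (Sp n)} (h : Unif s S ν)
    (V : Submodule ℝ (EuclideanSpace ℝ (Fin n))) (hS : ∀ z, z ∈ S ↔ z.1 ∈ V ∧ z.2 = 0) :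
    s = (Module.finrank ℝ V : ℝ) := by
  let j : V → Sp n := fun x => ((x : EuclideanSpace ℝ (Fin n)), 0)
  have hj : Measurable j := (by fun_prop : Continuous j).measurable
  have hm : volume (Metric.ball (0 : V) 1) ≠ ⊤ := measure_ball_lt_top.ne
  have hm0 : 0 < volume (Metric.ball (0 : V) 1) := Metric.measure_ball_pos _ _ one_pos
  have key : ∀ x ∈ S, ∀ r > 0, (Measure.map j volume) (ballK x r) =
      ENNReal.ofReal ((volume (Metric.ball (0 : V) 1)).toReal * r ^ (Module.finrank ℝ V : ℝ)) := by
    intro x hx r hr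
    obtain ⟨hx1, hx2⟩ := (hS x).1 hx
    rw [Measure.map_apply hj (measurableSet_ballK _ _)]
    have : j ⁻¹' ballK x r = Metric.closedBall ⟨x.1, hx1⟩ r := by
      ext y
      rw [mem_preimage, mem_ballK, dK_le_iff _ _ hr.le, Metric.mem_closedBall, dist_comm,
        Subtype.dist_eq, dist_eq_norm]
      simp only [j, hx2, sub_self]
      rw [show ‖x.1 - (y : EuclideanSpace ℝ (Fin n))‖ ^ 4 + (0 : ℝ) ^ 2 =
        ‖x.1 - (y : EuclideanSpace ℝ (Fin n))‖ ^ 4 by ring]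
      exact pow_le_pow_iff_left₀ (norm_nonneg _) hr.le (by norm_num)
    rw [this, Measure.addHaar_closedBall _ _ hr.le, Real.rpow_natCast, mul_comm (ENNReal.toReal _),
      ENNReal.ofReal_mul (by positivity), ENNReal.ofReal_toReal hm]
  refine h.dim_eq (ξ := Measure.map j volume) ?_ (ENNReal.toReal_pos hm0.ne' hm)
    (fun x hx r hr => (key x hx r hr).le) (fun x hx r hr => (key x hx r hr).ge)
  rw [Measure.map_apply hj h.closed.measurableSet.compl]
  convert measure_empty (μ := (volume : Measure V))
  refine eq_empty_of_forall_notMem fun x hx => hx ?_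
  exact (hS _).2 ⟨x.2, rfl⟩

lemma Unif.dim_vert {n : ℕ} {s : ℝ} {S : Set (Sp n)} {ν : Measure (Sp n)} (h : Unif s S ν)
    (V : Submodule ℝ (EuclideanSpace ℝ (Fin n))) (hS : ∀ z, z ∈ S ↔ z.1 ∈ V) :
    s = ((Module.finrank ℝ V + 2 : ℕ) : ℝ) := by
  let j : V × ℝ → Sp n := fun x => ((x.1 : EuclideanSpace ℝ (Fin n)), x.2)
  have hj : Measurable j := (by fun_prop : Continuous j).measurable
  have hm : volume (Metric.ball (0 : V) 1) ≠ ⊤ := measure_ball_lt_top.ne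
  have hm0 : 0 < volume (Metric.ball (0 : V) 1) := Metric.measure_ball_pos _ _ one_pos
  set m := (volume (Metric.ball (0 : V) 1)).toReal with hmdef
  have hmp : 0 < m := ENNReal.toReal_pos hm0.ne' hm
  have hbox : ∀ (x : V) (t r u : ℝ), 0 ≤ r → 0 ≤ u →
      ((volume : Measure V).prod (volume : Measure ℝ))
        (Metric.closedBall x r ×ˢ Metric.closedBall t u) =
      ENNReal.ofReal (r ^ Module.finrank ℝ V * m * (2 * u)) := by
    intro x t r u hr hu
    rw [Measure.prod_prod, Measure.addHaar_closedBall _ _ hr, Real.volume_closedBall,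
      ENNReal.ofReal_mul (p := r ^ Module.finrank ℝ V * m) (by positivity),
      ENNReal.ofReal_mul (p := r ^ Module.finrank ℝ V) (by positivity), hmdef,
      ENNReal.ofReal_toReal hm]
  refine h.dim_eq (ξ := Measure.map j (volume.prod volume)) (A := 2 * m)
    (c := m * (1 / 2) ^ Module.finrank ℝ V) ?_ (by positivity) ?_ ?_
  · rw [Measure.map_apply hj h.closed.measurableSet.compl]
    convert measure_empty (μ := (volume : Measure V).prod (volume : Measure ℝ))
    refine eq_empty_of_forall_notMem fun x hx => hx ?_
    exact (hS _).2 x.1.2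
  · intro x hx r hr
    rw [Measure.map_apply hj (measurableSet_ballK _ _)]
    refine (measure_mono (t := Metric.closedBall ⟨x.1, (hS x).1 hx⟩ r ×ˢ
      Metric.closedBall x.2 (r ^ 2)) ?_).trans ?_
    · intro y hy
      have hy : dK x (j y) ≤ r := hy
      refine ⟨?_, ?_⟩
      · rw [Metric.mem_closedBall, dist_comm, Subtype.dist_eq, dist_eq_norm]
        exact (norm_le_dK x (j y)).trans hy
      · rw [Metric.mem_closedBall, dist_comm, Real.dist_eq]
        exact (abs_le_dK x (j y)).trans (pow_le_pow_left₀ (dK_nonneg _ _) hy 2)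
    · rw [hbox _ _ _ _ hr.le (by positivity), Real.rpow_natCast]
      apply ENNReal.ofReal_le_ofReal
      apply le_of_eq; ring
  · intro x hx r hr
    rw [Measure.map_apply hj (measurableSet_ballK _ _)]
    refine le_trans ?_ (measure_mono (s := Metric.closedBall ⟨x.1, (hS x).1 hx⟩ (r / 2) ×ˢ
      Metric.closedBall x.2 (r ^ 2 / 2)) ?_)
    · rw [hbox _ _ _ _ (by positivity) (by positivity), Real.rpow_natCast]
      apply ENNReal.ofReal_le_ofReal
      apply le_of_eq
      rw [div_eq_mul_one_div r 2, mul_pow]; ring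
    · rintro y ⟨hy1, hy2⟩
      rw [Metric.mem_closedBall, dist_comm, Subtype.dist_eq, dist_eq_norm] at hy1
      rw [Metric.mem_closedBall, dist_comm, Real.dist_eq] at hy2
      rw [mem_preimage, mem_ballK, dK_le_iff _ _ hr.le]
      have b1 : ‖x.1 - (j y).1‖ ^ 4 ≤ (r / 2) ^ 4 := pow_le_pow_left₀ (norm_nonneg _) hy1 4
      have b2 : (x.2 - (j y).2) ^ 2 ≤ (r ^ 2 / 2) ^ 2 := by
        rw [← sq_abs]
        exact pow_le_pow_left₀ (abs_nonneg _) hy2 2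
      have b3 : 0 < r ^ 4 := by positivity
      nlinarith

/-- If `μ` is a Radon measure on `(ℝ^{n+1}, d)` such that `lim_{r→0⁺} r^{-s} μ(B_d(x,r))`
exists and is positive and finite on a set of positive `μ`-measure, then `s` is an integer. -/
theorem statement1 (n : ℕ) (s : ℝ) (hs : 0 < s)
    (μ : Measure (Sp n)) [μ.Regular]
    (h : 0 < μ {x : Sp n | ∃ d : ℝ≥0∞, 0 < d ∧ d < ⊤ ∧ HasDensityK μ s x d}) :
    ∃ k : ℤ, s = k := by
  obtain ⟨S0, ν0, h0⟩ := exists_unif μ hs h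
  let P : Set (Submodule ℝ (EuclideanSpace ℝ (Fin n))) :=
    {V | ∃ (S : Set (Sp n)) (ν : Measure (Sp n)), Unif s S ν ∧ ∀ z ∈ S, z.1 ∈ V}
  have hP : P.Nonempty := ⟨⊤, S0, ν0, h0, fun _ _ => Submodule.mem_top⟩
  obtain ⟨V, ⟨S, ν, hU, hSV⟩, hmin⟩ := WellFounded.has_min
    (wellFounded_lt (α := Submodule ℝ (EuclideanSpace ℝ (Fin n)))) P hP
  have hV : MinV s V := fun W hW S' ν' hU' hc => hmin W ⟨S', ν', hU', hc⟩ hW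
  obtain ⟨S', ν', h', hc | hc⟩ := hV.dichotomy hs hU hSV
  · exact ⟨(Module.finrank ℝ V + 2 : ℕ), by rw [h'.dim_vert V hc]; norm_cast⟩
  · exact ⟨(Module.finrank ℝ V : ℕ), by rw [h'.dim_flat V hc]; norm_cast⟩
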